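/- arXiv:1104.4367 — 3 statements merged into one kernel-verified Lean document; each statement's English description precedes it below -/
import Mathlib

section
/- If H is a graph on an even number of vertices whose circumference l satisfies l > |V(H)| − δ(H), then H contains a cycle of even length at least min(2·δ(H), |V(H)|). -/
open SimpleGraph Finset in
theorem aux_join {V : Type} {H : SimpleGraph V} {a b x y : V} (q : H.Walk a b) (P : H.Walk x y)
    (hq : q.IsPath) (hP : P.IsPath) (hd : ∀ z ∈ q.support, z ∉ P.support)
    (hxa : H.Adj x a) (hyb : H.Adj y b) (hlen : 1 ≤ q.length + P.length) :
    ∃ (u : V) (c : H.Walk u u), c.IsCycle ∧ c.length = q.length + P.length + 2 := by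
  have hp : (q.append (Walk.cons hyb.symm P.reverse)).IsPath := by
    rw [Walk.isPath_def, Walk.support_append, List.nodup_append']
    refine ⟨hq.support_nodup, ?_, ?_⟩
    · simpa using hP.support_nodup
    · intro z hz hz'
      exact hd z hz (by simpa using hz')
  refine ⟨x, Walk.cons hxa (q.append (Walk.cons hyb.symm P.reverse)), ?_, ?_⟩
  · rw [Walk.cons_isCycle_iff]
    refine ⟨hp, fun h => ?_⟩
    rw [Sym2.eq_swap] at h
    have := hp.length_eq_one_of_mem_edges h
    simp at this
    omega
  · simp; omega

open SimpleGraph Finset in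
theorem aux_arc {V : Type} {H : SimpleGraph V} {u : V} (c : H.Walk u u) (hc : c.IsCycle)
    (i j : ℕ) (hij : i < j) (hj : j ≤ c.length) :
    ∃ q : H.Walk (c.getVert j) (c.getVert i), q.IsPath ∧ q.length + (j - i) = c.length ∧
      ∀ z ∈ q.support, z ∈ c.support := by
  have hs : ((c.drop j).append (c.take i)).support =
      c.support.tail.drop (j-1) ++ c.support.tail.take i := by
    rw [Walk.support_append, Walk.drop_support_eq_support_drop_min, Walk.support_take]
    congr 1
    · rw [min_eq_left hj]
      cases j with
      | zero => omega
      | succ k => simp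
    · rw [← c.cons_tail_support]; rfl
  refine ⟨(c.drop j).append (c.take i), ?_, ?_, ?_⟩
  · rw [Walk.isPath_def, hs]
    have hn := hc.support_nodup
    rw [List.nodup_append']
    refine ⟨hn.sublist (List.drop_sublist _ _), hn.sublist (List.take_sublist _ _), ?_⟩
    exact (List.disjoint_take_drop hn (by omega)).symm
  · rw [Walk.length_append, Walk.drop_length, Walk.take_length]; omega
  · intro z hz
    rw [hs, List.mem_append] at hz
    rcases hz with hz | hz
    · exact List.mem_of_mem_tail (List.mem_of_mem_drop hz)
    · exact List.mem_of_mem_tail (List.mem_of_mem_take hz)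

theorem aux_parity (p : ℕ → Prop) [DecidablePred p] (t : ℕ) :
    Even (((Finset.range t).filter (fun i => ¬ (p i ↔ p (i+1)))).card) ↔ (p 0 ↔ p t) := by
  induction t with
  | zero => simp
  | succ t ih =>
    rw [Finset.range_add_one, Finset.filter_insert]
    split_ifs with h
    · rw [ih]; tauto
    · rw [Finset.card_insert_of_notMem (by simp), Nat.even_add_one, ih]; tauto

set_option maxHeartbeats 2000000 in
theorem aux_seq (t m l : ℕ) (g : ℕ → ℕ) (a b : ℕ → Prop) (ht : 2 ≤ t) (hm : 1 ≤ m)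
    (hsum : ∑ i ∈ Finset.range t, g i = l)
    (hat : a t ↔ a 0) (hbt : b t ↔ b 0) (hab : ∀ i ≤ t, a i ∨ b i)
    (ha : a 0) (hb : ∃ i < t, b i)
    (h2 : ∀ i < t, 2 ≤ g i)
    (hg : ∀ i < t, (a i ∧ b (i+1)) ∨ (b i ∧ a (i+1)) → m + 1 ≤ g i) :
    2 * t + 2 * m ≤ l + 2 ∧ (¬ Even l → ∃ i < t,
      (((a i ∧ b (i+1)) ∨ (b i ∧ a (i+1))) ∧ Even (l - g i + m + 1) ∧
        2 * t + 2 * m ≤ l - g i + m + 1 + 2) ∨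
      (((a i ∧ a (i+1)) ∨ (b i ∧ b (i+1))) ∧ Even (l - g i + 2) ∧
        2 * t + 2 * m ≤ l - g i + 2 + 2)) := by
  classical
  set good : ℕ → Prop := fun i => (a i ∧ b (i+1)) ∨ (b i ∧ a (i+1)) with hgood
  set G := (Finset.range t).filter good with hG
  -- even number of good gaps if no common index
  have hdis : (∀ i < t, ¬ (a i ∧ b i)) → Even G.card := by
    intro h
    have h' : ∀ i ≤ t, ¬ (a i ∧ b i) := by
      intro i hi
      rcases hi.lt_or_eq with hi | rfl
      · exact h i hi
      · rw [hat, hbt]; exact h 0 (by omega)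
    have := (aux_parity a t).2 hat.symm
    convert this using 2
    apply Finset.filter_congr
    intro i hi
    have hi := Finset.mem_range.1 hi
    have := hab i hi.le
    have := hab (i+1) hi
    have := h' i hi.le
    have := h' (i+1) hi
    simp only [hgood]; tauto
  have hG2 : 2 ≤ G.card := by
    by_cases h : ∀ i < t, ¬ (a i ∧ b i)
    · have he := hdis h
      have h0 : G.card ≠ 0 := by
        intro h0
        rw [Finset.card_eq_zero] at h0
        have hng : ∀ i < t, ¬ good i := by
          intro i hi hgi
          have : i ∈ G := by simp [hG, hi, hgi]
          simp [h0] at this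
        have hall : ∀ i < t, a i := by
          intro i
          induction i with
          | zero => intro _; exact ha
          | succ k ih =>
            intro hk
            have h1 := ih (by omega)
            have h2 := hng k (by omega)
            have h3 := hab (k+1) hk.le
            simp only [hgood] at h2
            tauto
        obtain ⟨i, hi, hbi⟩ := hb
        exact h i hi ⟨hall i hi, hbi⟩
      obtain ⟨k, hk⟩ := he
      omega
    · push Not at h
      obtain ⟨i, hi, hai, hbi⟩ := h
      have hi1 : good i := by
        have := hab (i+1) hi
        simp only [hgood]; tauto
      obtain ⟨j, hj, hji, hgj⟩ : ∃ j < t, j ≠ i ∧ good j := by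
        rcases Nat.eq_zero_or_pos i with rfl | hpos
        · refine ⟨t-1, by omega, by omega, ?_⟩
          have h1 := hab (t-1) (by omega)
          have h2 : t - 1 + 1 = t := by omega
          simp only [hgood, h2]
          tauto
        · refine ⟨i-1, by omega, by omega, ?_⟩
          have h1 := hab (i-1) (by omega)
          have h2 : i - 1 + 1 = i := by omega
          simp only [hgood, h2]
          tauto
      have : ({i, j} : Finset ℕ) ⊆ G := by
        intro z hz
        simp only [Finset.mem_insert, Finset.mem_singleton] at hz
        rcases hz with rfl | rfl
        · exact Finset.mem_filter.2 ⟨Finset.mem_range.2 hi, hi1⟩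
        · exact Finset.mem_filter.2 ⟨Finset.mem_range.2 hj, hgj⟩
      have h4 := Finset.card_le_card this
      rwa [Finset.card_pair (Ne.symm hji)] at h4
  obtain ⟨k, rfl⟩ : ∃ k, m = k + 1 := ⟨m - 1, by omega⟩
  have hlow : ∀ s ⊆ Finset.range t, 2 * s.card + k * (s.filter good).card ≤ ∑ i ∈ s, g i := by
    intro s hs
    calc 2 * s.card + k * (s.filter good).card = ∑ i ∈ s, (2 + if good i then k else 0) := by
          rw [Finset.sum_add_distrib, ← Finset.sum_filter]; simp [mul_comm]
      _ ≤ _ := by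
          apply Finset.sum_le_sum
          intro i hi
          have hi := Finset.mem_range.1 (hs hi)
          split_ifs with h
          · have := hg i hi h; omega
          · simpa using h2 i hi
  have hlow' : ∀ j < t, 2 * (t - 1) + k * (G.erase j).card ≤ l - g j := by
    intro j hj
    have h1 := hlow ((Finset.range t).erase j) (Finset.erase_subset _ _)
    have h3 := Finset.add_sum_erase (Finset.range t) g (Finset.mem_range.2 hj)
    rw [Finset.filter_erase, Finset.card_erase_of_mem (Finset.mem_range.2 hj), Finset.card_range] at h1
    rw [hsum] at h3
    change _ + k * (G.erase j).card ≤ _ at h1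
    omega
  have hgl : ∀ j < t, g j ≤ l := by
    intro j hj
    rw [← hsum]
    exact Finset.single_le_sum (f := g) (fun _ _ => Nat.zero_le _) (Finset.mem_range.2 hj)
  have hmulk : ∀ r s : ℕ, r ≤ s → k * r ≤ k * s := fun r s h => Nat.mul_le_mul_left k h
  constructor
  · have h1 := hlow _ (Finset.Subset.refl _)
    rw [hsum, Finset.card_range] at h1
    change _ + k * G.card ≤ _ at h1
    have := hmulk 2 _ hG2
    omega
  intro hodd
  rw [Nat.not_even_iff_odd] at hodd
  have hoc := hodd
  rw [← hsum, Finset.odd_sum_iff_odd_card_odd] at hoc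
  -- all good gaps replaceable
  have hgoodb : ∀ j < t, good j → 2 * t + 2 * (k+1) ≤ l - g j + (k + 1) + 1 + 2 := by
    intro j hj hgj
    have h1 := hlow' j hj
    have h3 : j ∈ G := by simp [hG, hj, hgj]
    rw [Finset.card_erase_of_mem h3] at h1
    have := hmulk 1 _ (show 1 ≤ G.card - 1 by omega)
    omega
  by_cases hbad : ∃ j < t, Odd (g j) ∧ ¬ good j
  · obtain ⟨j, hj, hoj, hgj⟩ := hbad
    refine ⟨j, hj, Or.inr ⟨?_, ?_, ?_⟩⟩
    · have := hab j hj.le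
      have := hab (j+1) hj
      simp only [hgood] at hgj; tauto
    · have := hgl j hj
      obtain ⟨r, hr⟩ := hoj
      obtain ⟨s, hs⟩ := hodd
      exact ⟨s - r + 1, by omega⟩
    · have h1 := hlow' j hj
      rw [Finset.erase_eq_of_notMem (by simp [hG, hgj])] at h1
      have := hmulk 2 _ hG2
      omega
  push Not at hbad
  by_cases hrep : ∃ j < t, good j ∧ Even (l - g j + (k+1) + 1)
  · obtain ⟨j, hj, hgj, he⟩ := hrep
    exact ⟨j, hj, Or.inl ⟨hgj, he, hgoodb j hj hgj⟩⟩
  push Not at hrep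
  -- every good gap is odd
  have hone : ∃ j < t, Odd (g j) := by
    by_contra h
    push Not at h
    rw [Finset.filter_false_of_mem] at hoc
    · simp at hoc
    · intro i hi; exact h i (Finset.mem_range.1 hi)
  obtain ⟨j0, hj0, ho0⟩ := hone
  have hgo : ∀ j < t, good j → Odd (g j) := by
    intro j hj hgj
    have e0 := hrep j0 hj0 (hbad j0 hj0 ho0)
    have e1 := hrep j hj hgj
    have := hgl j hj
    have := hgl j0 hj0
    rw [Nat.not_even_iff] at e0 e1
    rw [Nat.odd_iff] at *
    omega
  have hGo : Odd G.card := by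
    convert hoc using 2
    apply Finset.filter_congr
    intro i hi
    have hi := Finset.mem_range.1 hi
    exact ⟨hgo i hi, hbad i hi⟩
  have hG3 : 3 ≤ G.card := by
    obtain ⟨r, hr⟩ := hGo; omega
  have hboth : ∃ i < t, a i ∧ b i := by
    by_contra h
    push Not at h
    have := hdis (fun i hi hh => h i hi hh.1 hh.2)
    rw [← Nat.not_even_iff_odd] at hGo
    exact hGo this
  obtain ⟨i, hi, hai, hbi⟩ := hboth
  have hab1 := hab (i+1) hi
  have hgi : good i := by simp only [hgood]; tauto
  refine ⟨i, hi, Or.inr ⟨by tauto, ?_, ?_⟩⟩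
  · have := hgl i hi
    obtain ⟨r, hr⟩ := hgo i hi hgi
    obtain ⟨s, hs⟩ := hodd
    exact ⟨s - r + 1, by omega⟩
  · have h1 := hlow' i hi
    have h3 : i ∈ G := by simp [hG, hi, hgi]
    rw [Finset.card_erase_of_mem h3] at h1
    have := hmulk 2 _ (show 2 ≤ G.card - 1 by omega)
    omega

open SimpleGraph Finset in
theorem aux_path {V : Type} [Fintype V] {H : SimpleGraph V} (R : Set V) (v : V) (hv : v ∈ R) :
    ∃ (x y : V) (P : H.Walk x y), P.IsPath ∧ (∀ z ∈ P.support, z ∈ R) ∧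
      ∀ w ∈ R, H.Adj x w → w ∈ P.support := by
  classical
  let Q : ℕ → Prop := fun k => ∃ (x y : V) (P : H.Walk x y), P.IsPath ∧
    (∀ z ∈ P.support, z ∈ R) ∧ P.length = k
  have h0 : Q 0 := ⟨v, v, Walk.nil, Walk.IsPath.nil, by simpa using hv, rfl⟩
  have hs := Nat.findGreatest_spec (P := Q) (Nat.zero_le (Fintype.card V)) h0
  obtain ⟨x, y, P, hP, hR, hl⟩ := hs
  refine ⟨x, y, P, hP, hR, fun w hw hxw => ?_⟩
  by_contra hwP
  have hP' : (Walk.cons hxw.symm P).IsPath := by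
    rw [Walk.cons_isPath_iff]; exact ⟨hP, hwP⟩
  have := Nat.le_findGreatest (P := Q) (n := Fintype.card V) (m := P.length + 1)
    (by have := hP'.length_lt; simp at this; omega)
    ⟨w, y, Walk.cons hxw.symm P, hP', by
      intro z hz
      simp only [Walk.support_cons, List.mem_cons] at hz
      rcases hz with rfl | hz
      · exact hw
      · exact hR z hz, by simp⟩
  omega

set_option maxHeartbeats 2000000 in
open SimpleGraph Finset in
theorem aux_main {V : Type} [Fintype V] [DecidableEq V] (H : SimpleGraph V)
    [DecidableRel H.Adj] {u x y : V} (c : H.Walk u u) (hc : c.IsCycle)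
    (hmax : ∀ (u : V) (c' : H.Walk u u), c'.IsCycle → c'.length ≤ c.length)
    (P : H.Walk x y) (hP : P.IsPath) (hdisj : ∀ z ∈ P.support, z ∉ c.support)
    (hxu : H.Adj x u) (hy : ∃ z ∈ c.support, H.Adj y z) (d : ℕ)
    (hd : 2 ≤ d) (hxd : d ≤ (H.neighborFinset x ∩ c.support.toFinset).card) :
    ∃ (u : V) (c : H.Walk u u), c.IsCycle ∧ Even c.length ∧
      2 * (d + P.length) ≤ c.length := by
  classical
  set l := c.length with hl
  set f := c.getVert with hf
  have hl3 : 3 ≤ l := hc.three_le_length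
  have hf0 : f 0 = u := by simp [hf]
  have hfl : f l = u := by simp [hf, hl]
  have hsupp : ∀ z ∈ c.support, ∃ i < l, f i = z := by
    intro z hz
    obtain ⟨n, hn, hnl⟩ := Walk.mem_support_iff_exists_getVert.1 hz
    rcases hnl.lt_or_eq with h | h
    · exact ⟨n, h, hn⟩
    · refine ⟨0, by omega, ?_⟩
      rw [hf0, ← hn, h]; exact hfl.symm
  let p : ℕ → Prop := fun i => l ≤ i ∨ H.Adj x (f i) ∨ H.Adj y (f i)
  have hinf : (Set.ofPred p).Infinite := by
    apply Set.infinite_of_not_bddAbove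
    rintro ⟨N, hN⟩
    have := hN (show l + N + 1 ∈ Set.ofPred p from Or.inl (by omega))
    omega
  let s := Nat.nth p
  have hsm : StrictMono s := Nat.nth_strictMono hinf
  have hsp : ∀ i, p (s i) := Nat.nth_mem_of_infinite hinf
  have hp0 : p 0 := Or.inr (Or.inl (by rw [hf0]; exact hxu))
  have hpl : p l := Or.inl le_rfl
  set t := Nat.count p l with ht
  have hs0 : s 0 = 0 := by
    have := Nat.nth_count hp0
    simpa using this
  have hst : s t = l := Nat.nth_count hpl
  have hsl : ∀ i ≤ t, s i ≤ l := fun i hi => hst ▸ hsm.monotone hi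
  have hdt : d ≤ t := by
    refine hxd.trans ?_
    rw [ht, Nat.count_eq_card_filter_range]
    refine (Finset.card_le_card (t := ((Finset.range l).filter p).image f) ?_).trans
      Finset.card_image_le
    intro z hz
    simp only [Finset.mem_inter, mem_neighborFinset, List.mem_toFinset] at hz
    obtain ⟨i, hi, rfl⟩ := hsupp z hz.2
    exact Finset.mem_image.2 ⟨i, Finset.mem_filter.2 ⟨Finset.mem_range.2 hi, Or.inr (Or.inl hz.1)⟩, rfl⟩
  let a : ℕ → Prop := fun i => H.Adj x (f (s i))
  let b : ℕ → Prop := fun i => H.Adj y (f (s i))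
  let g : ℕ → ℕ := fun i => s (i+1) - s i
  have hft : f (s t) = f (s 0) := by rw [hst, hs0, hf0, hfl]
  have ha0 : a 0 := by simp only [a, hs0, hf0]; exact hxu
  have hxP : x ∈ P.support := P.start_mem_support
  have hyP : y ∈ P.support := P.end_mem_support
  have hlt : ∀ i < t, s i < s (i+1) ∧ s (i+1) ≤ l ∧ s (i+1) - s i < l := by
    intro i hi
    have h1 := hsm (Nat.lt_succ_self i)
    have h2 := hsl (i+1) hi
    refine ⟨h1, h2, ?_⟩
    rcases Nat.eq_zero_or_pos i with rfl | hpos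
    · have := hsm (show 0 + 1 < t by omega)
      rw [hst] at this
      omega
    · have := hsm hpos
      omega
  have hgoodc : ∀ i < t, (a i ∧ b (i+1)) ∨ (b i ∧ a (i+1)) →
      ∃ (u : V) (c : H.Walk u u), c.IsCycle ∧ c.length = l - g i + (P.length + 1) + 1 := by
    intro i hi h
    obtain ⟨h1, h2, h3⟩ := hlt i hi
    obtain ⟨q, hq, hql, hqs⟩ := aux_arc c hc _ _ h1 h2
    rcases h with h | h
    · obtain ⟨w, c', hc', hcl⟩ := aux_join q P.reverse hq hP.reverse
        (fun z hz hz' => hdisj z (by simpa using hz') (hqs z hz)) h.2 h.1 (by omega)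
      refine ⟨w, c', hc', ?_⟩
      rw [Walk.length_reverse] at hcl
      simp only [g]; omega
    · obtain ⟨w, c', hc', hcl⟩ := aux_join q P hq hP
        (fun z hz hz' => hdisj z hz' (hqs z hz)) h.2 h.1 (by omega)
      refine ⟨w, c', hc', ?_⟩
      simp only [g]; omega
  have hsamec : ∀ i < t, (a i ∧ a (i+1)) ∨ (b i ∧ b (i+1)) →
      ∃ (u : V) (c : H.Walk u u), c.IsCycle ∧ c.length = l - g i + 2 := by
    intro i hi h
    obtain ⟨h1, h2, h3⟩ := hlt i hi
    obtain ⟨q, hq, hql, hqs⟩ := aux_arc c hc _ _ h1 h2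
    rcases h with h | h
    · obtain ⟨w, c', hc', hcl⟩ := aux_join q (Walk.nil : H.Walk x x) hq Walk.IsPath.nil
        (fun z hz hz' => hdisj z (by
          simp only [Walk.support_nil, List.mem_singleton] at hz'; rw [hz']; exact hxP) (hqs z hz))
          h.2 h.1 (by omega)
      refine ⟨w, c', hc', ?_⟩
      rw [Walk.length_nil] at hcl
      simp only [g]; omega
    · obtain ⟨w, c', hc', hcl⟩ := aux_join q (Walk.nil : H.Walk y y) hq Walk.IsPath.nil
        (fun z hz hz' => hdisj z (by
          simp only [Walk.support_nil, List.mem_singleton] at hz'; rw [hz']; exact hyP) (hqs z hz))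
          h.2 h.1 (by omega)
      refine ⟨w, c', hc', ?_⟩
      rw [Walk.length_nil] at hcl
      simp only [g]; omega
  have hab : ∀ i ≤ t, a i ∨ b i := by
    intro i hi
    rcases hi.lt_or_eq with hi | rfl
    · have h1 := hsm hi
      rw [hst] at h1
      rcases hsp i with h | h
      · omega
      · exact h
    · left; simp only [a]; rw [hft]; exact ha0
  have hgl : ∀ i < t, g i < l := fun i hi => (hlt i hi).2.2
  have hgg : ∀ i < t, (a i ∧ b (i+1)) ∨ (b i ∧ a (i+1)) → (P.length + 1) + 1 ≤ g i := by
    intro i hi h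
    obtain ⟨w, c', hc', hcl⟩ := hgoodc i hi h
    have := hmax w c' hc'
    have := hgl i hi
    omega
  have hg2 : ∀ i < t, 2 ≤ g i := by
    intro i hi
    by_cases h : (a i ∧ b (i+1)) ∨ (b i ∧ a (i+1))
    · have := hgg i hi h; omega
    · have h1 := hab i hi.le
      have h2 := hab (i+1) hi
      obtain ⟨w, c', hc', hcl⟩ := hsamec i hi (by tauto)
      have := hmax w c' hc'
      have := hgl i hi
      omega
  have hb : ∃ i < t, b i := by
    obtain ⟨z, hz, hyz⟩ := hy
    obtain ⟨k, hk, rfl⟩ := hsupp z hz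
    have hpk : p k := Or.inr (Or.inr hyz)
    have hsk : s (Nat.count p k) = k := Nat.nth_count hpk
    exact ⟨Nat.count p k, Nat.count_strict_mono hpk hk, by simp only [b, hsk]; exact hyz⟩
  have hsum : ∑ i ∈ Finset.range t, g i = l := by
    have := Finset.sum_range_tsub hsm.monotone t
    rw [hst, hs0] at this
    simpa [g] using this
  obtain ⟨r1, r2⟩ := aux_seq t (P.length + 1) l g a b (by omega) (by omega) hsum
    (by simp only [a]; rw [hft]) (by simp only [b]; rw [hft]) hab ha0 hb hg2 hgg
  by_cases he : Even l
  · exact ⟨u, c, hc, he, by omega⟩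
  obtain ⟨i, hi, h | h⟩ := r2 he
  · obtain ⟨h1, h2, h3⟩ := h
    obtain ⟨w, c', hc', hcl⟩ := hgoodc i hi h1
    exact ⟨w, c', hc', by rw [hcl]; exact h2, by omega⟩
  · obtain ⟨h1, h2, h3⟩ := h
    obtain ⟨w, c', hc', hcl⟩ := hsamec i hi h1
    exact ⟨w, c', hc', by rw [hcl]; exact h2, by omega⟩

/-- If `|V(H)|` is even and the circumference `l` of `H` satisfies
`l > |V(H)| - δ(H)`, then `H` has an even cycle of length at least
`min (2 * δ(H)) |V(H)|`. -/
theorem stmt_2 {V : Type} [Fintype V] [DecidableEq V] (H : SimpleGraph V)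
    [DecidableRel H.Adj] (l : ℕ) (heven : Even (Fintype.card V))
    (hex : ∃ (u : V) (c : H.Walk u u), c.IsCycle ∧ c.length = l)
    (hmax : ∀ (u : V) (c : H.Walk u u), c.IsCycle → c.length ≤ l)
    (hl : Fintype.card V - H.minDegree < l) :
    ∃ (u : V) (c : H.Walk u u), c.IsCycle ∧ Even c.length ∧
      min (2 * H.minDegree) (Fintype.card V) ≤ c.length := by
  obtain ⟨u, c, hc, hcl⟩ := hex
  have hcard : c.support.toFinset.card = l := by
    have h1 : c.support.toFinset = c.support.tail.toFinset := by
      ext z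
      simp only [List.mem_toFinset]
      refine ⟨fun hz => ?_, List.mem_of_mem_tail⟩
      rw [← c.cons_tail_support, List.mem_cons] at hz
      rcases hz with rfl | hz
      · exact SimpleGraph.Walk.end_mem_tail_support hc.not_nil
      · exact hz
    rw [h1, List.toFinset_card_of_nodup hc.support_nodup, List.length_tail,
      SimpleGraph.Walk.length_support]
    omega
  have hln : l ≤ Fintype.card V := hcard ▸ Finset.card_le_univ _
  rcases hln.eq_or_lt with hln | hln
  · exact ⟨u, c, hc, by rw [hcl, hln]; exact heven, by omega⟩
  obtain ⟨v, hv⟩ : ∃ v, v ∉ c.support := by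
    by_contra h
    push Not at h
    have : c.support.toFinset = Finset.univ := by ext z; simp [h z]
    rw [this, Finset.card_univ] at hcard
    omega
  obtain ⟨x, y, P, hP, hR, hPm⟩ := aux_path (H := H) {z | z ∉ c.support} v hv
  have hPR : ∀ z ∈ P.support, z ∉ c.support := hR
  set δ := H.minDegree with hδ
  have hcompl : (c.support.toFinsetᶜ).card = Fintype.card V - l := by
    rw [Finset.card_compl, hcard]
  have hsplit : ∀ z, δ ≤ (H.neighborFinset z ∩ c.support.toFinset).card +
      (H.neighborFinset z \ c.support.toFinset).card := by
    intro z
    rw [Finset.card_inter_add_card_sdiff, SimpleGraph.card_neighborFinset_eq_degree]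
    exact H.minDegree_le_degree z
  have hPcard : P.support.toFinset.card = P.length + 1 := by
    rw [List.toFinset_card_of_nodup hP.support_nodup, SimpleGraph.Walk.length_support]
  have hPle : P.length + 1 ≤ Fintype.card V - l := by
    rw [← hPcard, ← hcompl]
    apply Finset.card_le_card
    intro z hz
    simp only [Finset.mem_compl, List.mem_toFinset] at hz ⊢
    exact hPR z hz
  have hxd : δ - P.length ≤ (H.neighborFinset x ∩ c.support.toFinset).card := by
    have h1 := hsplit x
    have h2 : (H.neighborFinset x \ c.support.toFinset).card ≤ P.length := by
      have : H.neighborFinset x \ c.support.toFinset ⊆ P.support.toFinset.erase x := by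
        intro z hz
        simp only [Finset.mem_sdiff, SimpleGraph.mem_neighborFinset, List.mem_toFinset,
          Finset.mem_erase] at hz ⊢
        exact ⟨hz.1.ne', hPm z hz.2 hz.1⟩
      have h3 := Finset.card_le_card this
      rw [Finset.card_erase_of_mem (by simp), hPcard] at h3
      omega
    omega
  have hy : ∃ z ∈ c.support, H.Adj y z := by
    have h1 := hsplit y
    have h2 : (H.neighborFinset y \ c.support.toFinset).card ≤ Fintype.card V - l := by
      rw [← hcompl]
      apply Finset.card_le_card
      intro z hz
      simp only [Finset.mem_sdiff, Finset.mem_compl] at hz ⊢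
      exact hz.2
    have h3 : 0 < (H.neighborFinset y ∩ c.support.toFinset).card := by omega
    obtain ⟨z, hz⟩ := Finset.card_pos.1 h3
    simp only [Finset.mem_inter, SimpleGraph.mem_neighborFinset, List.mem_toFinset] at hz
    exact ⟨z, hz.2, hz.1⟩
  obtain ⟨w, hw⟩ := Finset.card_pos.1 (show 0 < (H.neighborFinset x ∩ c.support.toFinset).card by
    omega)
  simp only [Finset.mem_inter, SimpleGraph.mem_neighborFinset, List.mem_toFinset] at hw
  have hsup : ∀ z, z ∈ (c.rotate w hw.2).support ↔ z ∈ c.support := fun z =>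
    SimpleGraph.Walk.mem_support_rotate_iff c w hw.2
  have hsf : (c.rotate w hw.2).support.toFinset = c.support.toFinset := by
    ext z; simp only [List.mem_toFinset, hsup]
  obtain ⟨u', c', h1, h2, h3⟩ := aux_main H (c.rotate w hw.2) (hc.rotate hw.2)
    (by intro u c'' h; rw [SimpleGraph.Walk.length_rotate, hcl]; exact hmax u c'' h)
    P hP (fun z hz hz' => hPR z hz ((hsup z).1 hz')) hw.1
    (by obtain ⟨z, hz, hyz⟩ := hy; exact ⟨z, (hsup z).2 hz, hyz⟩)
    (δ - P.length) (by omega) (by rw [hsf]; exact hxd)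
  exact ⟨u', c', h1, h2, by omega⟩
end

section
/- Let H be a graph on n vertices with δ(H) ≥ (2/3 − ε)n, where 0 < ε ≤ 1/500 and n ≥ 6000. Then H contains a square path on at least (1/2 − 3ε)n vertices. (One may assume as given the Fan–Kierstead results: every graph F with δ(F) ≥ (2|F| − 1)/3 has a hamiltonian square path, and for an optimal square path P in a graph and a vertex v off P, ‖v, Q‖ ≤ (2/3)|Q| + 1 for every segment Q of P and ‖v, P‖ ≤ (2/3)|P| − 1/3.) -/
def SP {V : Type} (G : SimpleGraph V) (t : ℕ) (p : ℕ → V) : Prop :=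
  Set.InjOn p (Set.Iio t) ∧
      (∀ i, i + 1 < t → G.Adj (p i) (p (i+1))) ∧
      (∀ i, i + 2 < t → G.Adj (p i) (p (i+2)))

lemma SP.near {V : Type} {G : SimpleGraph V} {t : ℕ} {p : ℕ → V} (h : SP G t p) (a b : ℕ)
    (ha : a < t) (hb : b < t) (hne : a ≠ b) (h1 : a ≤ b + 2) (h2 : b ≤ a + 2) :
    G.Adj (p a) (p b) := by
  obtain ⟨_, h1', h2'⟩ := h
  have : b = a + 1 ∨ b = a + 2 ∨ a = b + 1 ∨ a = b + 2 := by omega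
  rcases this with rfl | rfl | rfl | rfl
  · exact h1' _ hb
  · exact h2' _ hb
  · exact (h1' _ ha).symm
  · exact (h2' _ ha).symm

/-- general criterion for a re-indexed path -/
lemma SP.reindex {V : Type} {G : SimpleGraph V} {t : ℕ} {p : ℕ → V} (h : SP G t p)
    (l : ℕ) (σ : ℕ → ℕ) (hr : ∀ i < l, σ i < t)
    (hi : ∀ i < l, ∀ j < l, σ i = σ j → i = j)
    (h1 : ∀ i, i + 1 < l → G.Adj (p (σ i)) (p (σ (i+1))))
    (h2 : ∀ i, i + 2 < l → G.Adj (p (σ i)) (p (σ (i+2)))) : SP G l (fun i => p (σ i)) := by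
  refine ⟨?_, h1, h2⟩
  intro i hi' j hj hij
  exact hi i hi' j hj (h.1 (hr i hi') (hr j hj) hij)

set_option maxHeartbeats 4000000 in
lemma SP.shift {V : Type} {G : SimpleGraph V} {t : ℕ} {p : ℕ → V} (h : SP G t p)
    (v : V) (hv : ∀ i < t, p i ≠ v) (s g : ℕ) (hs : s + 3 * g + 3 < t)
    (v0 : G.Adj v (p s)) (v1 : G.Adj v (p (s+1))) (v2 : G.Adj v (p (s+2)))
    (v3 : g = 0 → G.Adj v (p (s+3))) (v4 : 1 ≤ g → G.Adj v (p (s+4)))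
    (hf : ∀ j, 1 ≤ j → j < g → G.Adj (p (s+3*j)) (p (s+3*j+4)))
    (hst : 1 ≤ g → G.Adj (p (s+3*g)) (p (s+3*g+3))) :
    ∃ w, SP G (t+1) w := by
  classical
  have N := h.near
  -- index function
  let σ : ℕ → ℕ := fun i => if i < s + 2 then i else if i = s + 2 then t
    else if i ≤ s + 3 * g + 3 then
      (if (i - s) % 3 = 2 then i - 2 else if (i - s) % 3 = 0 then i - 1 else i)
    else i - 1
  let q : ℕ → V := fun i => if i = t then v else p i
  have hq : ∀ i, i < t → q i = p i := fun i hi => by simp [q, hi.ne]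
  have hqt : q t = v := by simp [q]
  have hqi : Set.InjOn q (Set.Iio (t+1)) := by
    intro i hi j hj hij
    simp only [Set.mem_Iio] at hi hj
    simp only [q] at hij
    split_ifs at hij with a b b
    · omega
    · exact absurd hij.symm (hv j (by omega))
    · exact absurd hij (hv i (by omega))
    · exact h.1 (show i < t by omega) (show j < t by omega) hij
  have key1 : ∀ i, i + 1 < t + 1 → G.Adj (q (σ i)) (q (σ (i+1))) := by
    intro i hi
    rcases lt_trichotomy i (s+1) with hc | hc | hc
    · have e1 : σ i = i := by simp only [σ]; split_ifs <;> omega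
      have e2 : σ (i+1) = i+1 := by simp only [σ]; split_ifs <;> omega
      rw [e1, e2, hq _ (by omega), hq _ (by omega)]; apply N <;> omega
    · have e1 : σ i = s+1 := by simp only [σ]; split_ifs <;> omega
      have e2 : σ (i+1) = t := by simp only [σ]; split_ifs <;> omega
      rw [e1, e2, hqt, hq _ (by omega)]; exact v1.symm
    · rcases eq_or_ne i (s+2) with hc2 | hc2
      · have e1 : σ i = t := by simp only [σ]; split_ifs <;> omega
        have e2 : σ (i+1) = s+2 := by simp only [σ]; split_ifs <;> omega
        rw [e1, e2, hqt, hq _ (by omega)]; exact v2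
      · have e1 : σ i < t ∧ σ (i+1) < t ∧ σ i ≠ σ (i+1) ∧ σ i ≤ σ (i+1) + 2 ∧ σ (i+1) ≤ σ i + 2 := by
          simp only [σ]; split_ifs <;> omega
        rw [hq _ e1.1, hq _ e1.2.1]; apply N <;> omega
  have key2 : ∀ i, i + 2 < t + 1 → G.Adj (q (σ i)) (q (σ (i+2))) := by
    intro i hi
    rcases lt_trichotomy i s with hc | hc | hc
    · have e1 : σ i = i := by simp only [σ]; split_ifs <;> omega
      have e2 : σ (i+2) = i+2 := by simp only [σ]; split_ifs <;> omega
      rw [e1, e2, hq _ (by omega), hq _ (by omega)]; apply N <;> omega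
    · have e1 : σ i = s := by simp only [σ]; split_ifs <;> omega
      have e2 : σ (i+2) = t := by simp only [σ]; split_ifs <;> omega
      rw [e1, e2, hqt, hq _ (by omega)]; exact v0.symm
    · rcases eq_or_ne i (s+2) with hc2 | hc2
      · have e1 : σ i = t := by simp only [σ]; split_ifs <;> omega
        rcases Nat.eq_zero_or_pos g with hg | hg
        · have e2 : σ (i+2) = s+3 := by simp only [σ]; split_ifs <;> omega
          rw [e1, e2, hqt, hq _ (by omega)]; exact v3 hg
        · have e2 : σ (i+2) = s+4 := by simp only [σ]; split_ifs <;> omega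
          rw [e1, e2, hqt, hq _ (by omega)]; exact v4 hg
      · by_cases hm : (i - s) % 3 = 2 ∧ i ≤ s + 3 * g + 2
        · obtain ⟨j, rfl⟩ : ∃ j, i = s + 2 + 3 * j := ⟨(i - s) / 3, by omega⟩
          have e1 : σ (s + 2 + 3 * j) = s + 3 * j := by simp only [σ]; split_ifs <;> omega
          rcases Nat.lt_or_ge j g with hj | hj
          · have e2 : σ (s + 2 + 3 * j + 2) = s + 3 * j + 4 := by
              simp only [σ]; split_ifs <;> omega
            rw [e1, e2, hq _ (by omega), hq _ (by omega)]; exact hf j (by omega) hj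
          · have : j = g := by omega
            subst this
            have e2 : σ (s + 2 + 3 * j + 2) = s + 3 * j + 3 := by
              simp only [σ]; split_ifs <;> omega
            rw [e1, e2, hq _ (by omega), hq _ (by omega)]; exact hst (by omega)
        · have e1 : σ i < t ∧ σ (i+2) < t ∧ σ i ≠ σ (i+2) ∧ σ i ≤ σ (i+2) + 2 ∧ σ (i+2) ≤ σ i + 2 := by
            simp only [σ]; split_ifs <;> omega
          rw [hq _ e1.1, hq _ e1.2.1]; apply N <;> omega
  refine ⟨fun i => q (σ i), ?_, key1, key2⟩
  intro i hi j hj hij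
  simp only [Set.mem_Iio] at hi hj
  have hr : ∀ i < t + 1, σ i < t + 1 := by
    intro i hi
    simp only [σ]; split_ifs <;> omega
  have := hqi (hr i hi) (hr j hj) hij
  simp only [σ] at this
  split_ifs at this <;> omega

lemma SP.swap {V : Type} [DecidableEq V] {G : SimpleGraph V} {t : ℕ} {p : ℕ → V} (h : SP G t p)
    (v : V) (hv : ∀ i < t, p i ≠ v) (z : ℕ)
    (ha : ∀ i < t, i ≠ z → i ≤ z + 2 → z ≤ i + 2 → G.Adj v (p i)) :
    SP G t (Function.update p z v) := by
  have N := h.near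
  refine ⟨?_, ?_, ?_⟩
  · intro i hi j hj hij
    simp only [Set.mem_Iio] at hi hj
    simp only [Function.update_apply] at hij
    split_ifs at hij with a b b
    · omega
    · exact absurd hij.symm (hv j (by omega))
    · exact absurd hij (hv i (by omega))
    · exact h.1 hi hj hij
  · intro i hi
    simp only [Function.update_apply]
    split_ifs with a b b
    · omega
    · apply ha <;> omega
    · refine (ha i ?_ ?_ ?_ ?_).symm <;> omega
    · apply N <;> omega
  · intro i hi
    simp only [Function.update_apply]
    split_ifs with a b b
    · omega
    · apply ha <;> omega
    · refine (ha i ?_ ?_ ?_ ?_).symm <;> omega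
    · apply N <;> omega

lemma SP.append {V : Type} [DecidableEq V] {G : SimpleGraph V} {t : ℕ} {p : ℕ → V} (h : SP G t p)
    (v : V) (hv : ∀ i < t, p i ≠ v)
    (ha : ∀ i < t, t ≤ i + 2 → G.Adj (p i) v) :
    SP G (t+1) (Function.update p t v) := by
  have N := h.near
  refine ⟨?_, ?_, ?_⟩
  · intro i hi j hj hij
    simp only [Set.mem_Iio] at hi hj
    simp only [Function.update_apply] at hij
    split_ifs at hij with a b b
    · omega
    · exact absurd hij.symm (hv j (by omega))
    · exact absurd hij (hv i (by omega))
    · exact h.1 (show i < t by omega) (show j < t by omega) hij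
  · intro i hi
    simp only [Function.update_apply]
    split_ifs with a b b
    · omega
    · omega
    · apply ha <;> omega
    · apply N <;> omega
  · intro i hi
    simp only [Function.update_apply]
    split_ifs with a b b
    · omega
    · omega
    · apply ha <;> omega
    · apply N <;> omega
open Finset in
lemma cnt_succ (a : ℕ → Prop) [DecidablePred a] (s b : ℕ) (h : s ≤ b) :
    #{i ∈ Ico s (b+1) | a i} = #{i ∈ Ico s b | a i} + if a b then 1 else 0 := by
  rw [← Finset.insert_Ico_right_eq_Ico_add_one h, Finset.filter_insert]
  split_ifs with hb
  · rw [Finset.card_insert_of_notMem (by simp)]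
  · simp

def Wn (a : ℕ → Prop) (i : ℕ) : Prop :=
  ∃ s m, s + 3 * m + 3 = i ∧ ∀ j < 3 * m + 3, (a (s + j) ↔ ¬ (j % 3 = 0 ∧ 0 < j))

open Finset in
lemma cnt_pattern (a : ℕ → Prop) [DecidablePred a] (t : ℕ)
    (hno : ¬ ∃ s m, s + 3 * m + 3 < t ∧
      ∀ j ≤ 3 * m + 3, (a (s + j) ↔ ¬ (j % 3 = 0 ∧ 0 < j ∧ j < 3 * m + 3)))
    (s b : ℕ) (hs : s ≤ b) (hb : b ≤ t) :
    3 * #{i ∈ Ico s b | a i} ≤ 2 * (b - s) + 3 := by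
  have hW : ∀ i, i < t → Wn a i → ¬ a i := by
    rintro i hi ⟨s, m, e, hj⟩ hai
    refine hno ⟨s, m, by omega, ?_⟩
    intro j hj'
    rcases Nat.lt_or_ge j (3*m+3) with h | h
    · rw [hj j h]; constructor <;> intro h1 <;> omega
    · have : j = 3*m+3 := by omega
      subst this
      rw [← add_assoc, e]; simp [hai]
  have key : ∀ b, s ≤ b → b ≤ t →
      (3 * #{i ∈ Ico s b | a i} ≤ 2 * (b - s)) ∨
      (3 * #{i ∈ Ico s b | a i} ≤ 2 * (b - s) + 1 ∧ 1 ≤ b ∧ a (b-1)) ∨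
      (3 * #{i ∈ Ico s b | a i} ≤ 2 * (b - s) + 2 ∧ 2 ≤ b ∧ a (b-1) ∧ a (b-2)) ∨
      (3 * #{i ∈ Ico s b | a i} ≤ 2 * (b - s) + 3 ∧ Wn a b) ∨
      (3 * #{i ∈ Ico s b | a i} ≤ 2 * (b - s) + 1 ∧ 1 ≤ b ∧ ¬ a (b-1) ∧ Wn a (b-1)) ∨
      (3 * #{i ∈ Ico s b | a i} ≤ 2 * (b - s) + 2 ∧ 2 ≤ b ∧ a (b-1) ∧ ¬ a (b-2) ∧ Wn a (b-2)) := by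
    intro b hs
    induction b, hs using Nat.le_induction with
    | base => intro _; left; simp
    | succ b hs ih =>
      intro hb
      have := ih (by omega)
      rw [cnt_succ a s b hs]
      have h3 : a b → 2 ≤ b → a (b-1) → a (b-2) → Wn a (b+1) := by
        intro h1 h2 h3 h4
        refine ⟨b-2, 0, by omega, ?_⟩
        intro j hj
        have : j = 0 ∨ j = 1 ∨ j = 2 := by omega
        rcases this with rfl | rfl | rfl
        · simpa using h4
        · rw [show b - 2 + 1 = b - 1 by omega]; simpa using h3
        · rw [show b - 2 + 2 = b by omega]; simpa using h1
      have h6 : a b → 2 ≤ b → a (b-1) → ¬ a (b-2) → Wn a (b-2) → Wn a (b+1) := by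
        rintro h1 h2 h3 h4 ⟨s', m, e, hj⟩
        refine ⟨s', m+1, by omega, ?_⟩
        intro j hj'
        rcases Nat.lt_or_ge j (3*m+3) with h | h
        · exact hj j h
        · have : j = 3*m+3 ∨ j = 3*m+4 ∨ j = 3*m+5 := by omega
          rcases this with rfl | rfl | rfl
          · rw [show s' + (3*m+3) = b-2 by omega]; constructor
            · intro h; exact absurd h h4
            · intro h; omega
          · rw [show s' + (3*m+4) = b-1 by omega]; constructor
            · intro h; omega
            · intro h; exact h3
          · rw [show s' + (3*m+5) = b by omega]; constructor
            · intro h; omega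
            · intro h; exact h1
      have hw := hW b (by omega)
      simp only [Nat.add_sub_cancel, show b + 1 - 2 = b - 1 by omega]
      by_cases hab : a b
      · simp only [hab, if_true]
        rcases this with h | h | h | h | h | h
        · right; left; refine ⟨by omega, by omega, trivial⟩
        · right; right; left; exact ⟨by omega, by omega, trivial, h.2.2⟩
        · right; right; right; left
          exact ⟨by omega, h3 hab h.2.1 h.2.2.1 h.2.2.2⟩
        · exact absurd hab (hw h.2)
        · right; right; right; right; right
          exact ⟨by omega, by omega, trivial, h.2.2.1, h.2.2.2⟩
        · right; right; right; left
          exact ⟨by omega, h6 hab h.2.1 h.2.2.1 h.2.2.2.1 h.2.2.2.2⟩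
      · simp only [hab, if_false]
        rcases this with h | h | h | h | h | h
        · left; omega
        · left; omega
        · left; omega
        · right; right; right; right; left
          exact ⟨by omega, by omega, not_false, h.2⟩
        · left; omega
        · left; omega
  have := key b hs hb
  omega

open Finset in
lemma cnt_half (a : ℕ → Prop) [DecidablePred a] (s b : ℕ) (hs : s ≤ b)
    (hno : ∀ i, s ≤ i → i + 1 < b → a i → a (i+1) → False) :
    2 * #{i ∈ Ico s b | a i} ≤ (b - s) + 1 := by
  have key : ∀ c, s ≤ c → c ≤ b →
      (2 * #{i ∈ Ico s c | a i} ≤ (c - s)) ∨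
      (2 * #{i ∈ Ico s c | a i} ≤ (c - s) + 1 ∧ s + 1 ≤ c ∧ a (c-1)) := by
    intro c hs
    induction c, hs using Nat.le_induction with
    | base => intro _; left; simp
    | succ c hs ih =>
      intro hb
      rw [cnt_succ a s c hs]
      simp only [Nat.add_sub_cancel]
      have := ih (by omega)
      by_cases hab : a c
      · simp only [hab, if_true]
        rcases this with h | h
        · right; exact ⟨by omega, by omega, trivial⟩
        · exfalso
          refine hno (c-1) (by omega) (by omega) h.2.2 ?_
          rwa [Nat.sub_add_cancel (by omega)]
      · simp only [hab, if_false]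
        left
        rcases this with h | h <;> omega
  have := key b hs le_rfl
  omega

def chS {V : Type} (G : SimpleGraph V) [DecidableRel G.Adj] (t : ℕ) (k : ℕ) (p : ℕ → V) : Finset ℕ :=
  (Finset.range t).filter (fun i => i + k < t ∧ G.Adj (p i) (p (i+k)))

def pot {V : Type} (G : SimpleGraph V) [DecidableRel G.Adj] (t : ℕ) (p : ℕ → V) : ℕ :=
  (chS G t 3 p).card * (t + 1) + (chS G t 4 p).card

lemma chS_card_le {V : Type} (G : SimpleGraph V) [DecidableRel G.Adj] (t k : ℕ) (p : ℕ → V) :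
    (chS G t k p).card ≤ t := by
  refine (Finset.card_filter_le _ _).trans ?_
  simp

def Opt {V : Type} (G : SimpleGraph V) [DecidableRel G.Adj] (t : ℕ) (p : ℕ → V) : Prop :=
  SP G t p ∧ (∀ t' p', SP G t' p' → t' ≤ t) ∧ ∀ p', SP G t p' → pot G t p' ≤ pot G t p

lemma exists_opt {V : Type} [Fintype V] [Nonempty V] (G : SimpleGraph V) [DecidableRel G.Adj] :
    ∃ t p, Opt G t p := by
  classical
  have hb : ∀ t p, SP G t p → t ≤ Fintype.card V := by
    intro t p h
    have := Finset.card_le_card_of_injOn (s := Finset.range t) (t := Finset.univ) p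
      (by intro _ _; simp) (by intro i hi j hj; exact h.1 (by simpa using hi) (by simpa using hj))
    simpa using this
  have h0 : ∃ t, ∃ p, SP G t p := ⟨0, fun _ => Classical.arbitrary V, by
    refine ⟨?_, ?_, ?_⟩
    · intro i hi; simp at hi
    · intro i hi; omega
    · intro i hi; omega⟩
  obtain ⟨t0, ht0⟩ := h0
  have hP := Nat.findGreatest_spec (P := fun t => ∃ p, SP G t p) (n := Fintype.card V)
    (hb t0 _ ht0.choose_spec) ht0
  set t := Nat.findGreatest (fun t => ∃ p, SP G t p) (Fintype.card V) with ht
  have hmax : ∀ t' p', SP G t' p' → t' ≤ t := by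
    intro t' p' h
    exact Nat.le_findGreatest (P := fun t => ∃ p, SP G t p) (hb _ _ h) ⟨p', h⟩
  obtain ⟨p0, hp0⟩ := hP
  have hpb : ∀ p, pot G t p ≤ t * (t+1) + t := by
    intro p
    unfold pot
    have := chS_card_le G t 3 p
    have := chS_card_le G t 4 p
    gcongr
  have hQ := Nat.findGreatest_spec (P := fun x => ∃ p, SP G t p ∧ pot G t p = x)
    (n := t * (t+1) + t) (hpb p0) ⟨p0, hp0, rfl⟩
  obtain ⟨p, hp, hpx⟩ := hQ
  refine ⟨t, p, hp, hmax, ?_⟩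
  intro p' hp'
  rw [hpx]
  exact Nat.le_findGreatest (P := fun x => ∃ p, SP G t p ∧ pot G t p = x) (hpb p') ⟨p', hp', rfl⟩

lemma pot_lt3 {V : Type} (G : SimpleGraph V) [DecidableRel G.Adj] (t : ℕ) (p p' : ℕ → V)
    (h : chS G t 3 p ⊂ chS G t 3 p') : pot G t p < pot G t p' := by
  have := Finset.card_lt_card h
  have h4 := chS_card_le G t 4 p
  unfold pot
  nlinarith

lemma pot_lt4 {V : Type} (G : SimpleGraph V) [DecidableRel G.Adj] (t : ℕ) (p p' : ℕ → V)
    (h3 : chS G t 3 p ⊆ chS G t 3 p')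
    (h : chS G t 4 p ⊂ chS G t 4 p') : pot G t p < pot G t p' := by
  have := Finset.card_lt_card h
  have h4 := Finset.card_le_card h3
  unfold pot
  nlinarith

lemma chS_update_sub {V : Type} [DecidableEq V] (G : SimpleGraph V) [DecidableRel G.Adj]
    (t k : ℕ) (p : ℕ → V) (z : ℕ) (v : V)
    (h1 : z + k < t → G.Adj (p z) (p (z+k)) → G.Adj v (p (z+k)))
    (h2 : k ≤ z → G.Adj (p (z-k)) (p z) → G.Adj (p (z-k)) v) :
    k ≠ 0 → chS G t k p ⊆ chS G t k (Function.update p z v) := by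
  intro hk i hi
  simp only [chS, Finset.mem_filter, Function.update_apply] at hi ⊢
  refine ⟨hi.1, hi.2.1, ?_⟩
  obtain ⟨_, h3, h4⟩ := hi
  split_ifs with a b b
  · omega
  · subst a; exact h1 h3 h4
  · subst b; simp only [Nat.add_sub_cancel] at h2; exact h2 (by omega) h4
  · exact h4

lemma chS_update_mem {V : Type} [DecidableEq V] (G : SimpleGraph V) [DecidableRel G.Adj]
    (t k : ℕ) (p : ℕ → V) (z : ℕ) (v : V) (hz : z + k < t) (hk : k ≠ 0)
    (h : G.Adj v (p (z+k))) : z ∈ chS G t k (Function.update p z v) := by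
  simp only [chS, Finset.mem_filter, Function.update_apply, Finset.mem_range]
  refine ⟨by omega, hz, ?_⟩
  rw [if_pos trivial, if_neg (by omega)]; exact h

lemma chS_update_mem' {V : Type} [DecidableEq V] (G : SimpleGraph V) [DecidableRel G.Adj]
    (t k : ℕ) (p : ℕ → V) (z : ℕ) (v : V) (hz : z + k < t) (hk : k ≠ 0)
    (h : G.Adj v (p z)) : z ∈ chS G t k (Function.update p (z+k) v) := by
  simp only [chS, Finset.mem_filter, Function.update_apply, Finset.mem_range]
  refine ⟨by omega, hz, ?_⟩
  rw [if_neg (by omega), if_pos trivial]; exact h.symm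

lemma Opt.no_pattern {V : Type} [DecidableEq V] {G : SimpleGraph V} [DecidableRel G.Adj] {t : ℕ}
    {p : ℕ → V} (h : Opt G t p) (v : V) (hv : ∀ i < t, p i ≠ v) :
    ¬ ∃ s m, s + 3 * m + 3 < t ∧
      ∀ j ≤ 3 * m + 3, (G.Adj v (p (s + j)) ↔ ¬ (j % 3 = 0 ∧ 0 < j ∧ j < 3 * m + 3)) := by
  rintro ⟨s, m, hs, hpat⟩
  obtain ⟨hp, hmax, hpot⟩ := h
  have one : ∀ j ≤ 3 * m + 3, ¬ (j % 3 = 0 ∧ 0 < j ∧ j < 3 * m + 3) → G.Adj v (p (s+j)) :=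
    fun j hj h => (hpat j hj).2 h
  have one' : ∀ x, s ≤ x → x ≤ s + 3 * m + 3 →
      ¬ ((x - s) % 3 = 0 ∧ 0 < x - s ∧ x - s < 3 * m + 3) → G.Adj v (p x) := by
    intro x h1 h2 h3
    have := one (x - s) (by omega) h3
    rwa [Nat.add_sub_cancel' h1] at this
  have v0 : G.Adj v (p s) := one' s (by omega) (by omega) (by omega)
  have v1 := one 1 (by omega) (by omega)
  have v2 := one 2 (by omega) (by omega)
  have noP : ∀ w, ¬ SP G (t+1) w := fun w hw => by have := hmax _ _ hw; omega
  rcases Nat.eq_zero_or_pos m with hm | hm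
  · subst hm
    obtain ⟨w, hw⟩ := hp.shift v hv s 0 (by omega) v0 v1 v2 (fun _ => one 3 (by omega) (by omega))
      (by omega) (by omega) (by omega)
    exact noP w hw
  have v4 := one 4 (by omega) (by omega)
  -- the critical index
  obtain ⟨h, h1, hm', hfwd, hlast⟩ : ∃ h, 1 ≤ h ∧ h ≤ m ∧
      (∀ j, 1 ≤ j → j < h → G.Adj (p (s+3*j)) (p (s+3*j+4))) ∧
      (h = m ∨ (h < m ∧ ¬ G.Adj (p (s+3*h)) (p (s+3*h+4)))) := by
    have hex : ∃ h, 1 ≤ h ∧ (h = m ∨ (h < m ∧ ¬ G.Adj (p (s+3*h)) (p (s+3*h+4)))) :=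
      ⟨m, hm, Or.inl rfl⟩
    classical
    refine ⟨Nat.find hex, (Nat.find_spec hex).1, Nat.find_min' hex ⟨hm, Or.inl rfl⟩, ?_,
      (Nat.find_spec hex).2⟩
    intro j hj hj'
    have hle : Nat.find hex ≤ m := Nat.find_min' hex ⟨hm, Or.inl rfl⟩
    by_contra hc
    exact Nat.find_min hex hj' ⟨hj, Or.inr ⟨by omega, hc⟩⟩
  have hbar : ∀ g, 1 ≤ g → g ≤ h → ¬ G.Adj (p (s+3*g)) (p (s+3*g+3)) := by
    intro g hg hgh hc
    obtain ⟨w, hw⟩ := hp.shift v hv s g (by omega) v0 v1 v2 (by omega) (fun _ => v4)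
      (fun j hj hj' => hfwd j hj (by omega)) (fun _ => hc)
    exact noP w hw
  have hsw : SP G t (Function.update p (s+3*h) v) := by
    apply hp.swap v hv
    intro i hi hne ha hb
    apply one' <;> omega
  have hnl := hpot _ hsw
  have hb3 : 2 ≤ h → ¬ G.Adj (p (s+3*h-3)) (p (s+3*h)) := by
    intro h2
    have := hbar (h-1) (by omega) (by omega)
    rwa [show s + 3 * (h-1) = s + 3 * h - 3 by omega, show s + 3 * h - 3 + 3 = s + 3 * h by omega]
      at this
  have hsub3 : chS G t 3 p ⊆ chS G t 3 (Function.update p (s+3*h) v) := by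
    apply chS_update_sub
    · intro _ hc; exact absurd hc (hbar h h1 le_rfl)
    · intro _ hc
      rcases Nat.lt_or_ge h 2 with h2 | h2
      · have : h = 1 := by omega
        subst this
        simpa using v0.symm
      · exact absurd hc (hb3 h2)
    · omega
  rcases hlast with rfl | ⟨hlt, hnf⟩
  · -- strict gain of a 3-chord at the end
    have : chS G t 3 p ⊂ chS G t 3 (Function.update p (s+3*h) v) := by
      refine (Finset.ssubset_iff_of_subset hsub3).2 ⟨s+3*h, ?_, ?_⟩
      · exact chS_update_mem G t 3 p _ v (by omega) (by omega) (one' _ (by omega) (by omega) (by omega))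
      · intro hc
        simp only [chS, Finset.mem_filter] at hc
        exact hbar h h1 le_rfl hc.2.2
    have := pot_lt3 G t _ _ this
    omega
  · have hz4 : s + 3*h ∈ chS G t 4 (Function.update p (s+3*h) v) :=
      chS_update_mem G t 4 p _ v (by omega) (by omega) (one' _ (by omega) (by omega) (by omega))
    have hz4' : s + 3*h ∉ chS G t 4 p := by
      intro hc
      simp only [chS, Finset.mem_filter] at hc
      exact hnf hc.2.2
    suffices hsub4 : chS G t 4 p ⊆ chS G t 4 (Function.update p (s+3*h) v) by
      have : chS G t 4 p ⊂ chS G t 4 (Function.update p (s+3*h) v) :=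
        (Finset.ssubset_iff_of_subset hsub4).2 ⟨s+3*h, hz4, hz4'⟩
      have := pot_lt4 G t _ _ hsub3 this
      omega
    apply chS_update_sub
    · intro _ hc; exact absurd hc hnf
    · intro h4 hc
      rcases Nat.lt_or_ge h 2 with h2 | h2
      · have hh : h = 1 := by omega
        subst hh
        exfalso
        -- p (s+3) must be adjacent to p s
        have ha : G.Adj (p s) (p (s+3)) := by
          by_contra hna
          have : chS G t 3 p ⊂ chS G t 3 (Function.update p (s+3*1) v) := by
            refine (Finset.ssubset_iff_of_subset hsub3).2 ⟨s, ?_, ?_⟩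
            · exact chS_update_mem' G t 3 p s v (by omega) (by omega) v0
            · intro hc
              simp only [chS, Finset.mem_filter] at hc
              exact hna hc.2.2
          have := pot_lt3 G t _ _ this
          omega
        have hu : ∀ x, x ≠ s + 3 * 1 → Function.update p (s+3*1) v x = p x := by
          intro x hx; rw [Function.update_apply, if_neg hx]
        obtain ⟨w, hw⟩ := hsw.shift (p (s+3)) (by
            intro i hi
            rw [Function.update_apply]
            split_ifs with hc
            · exact (hv (s+3) (by omega)).symm
            · intro hc2
              have := hp.1 (show i < t by omega) (show s + 3 < t by omega) hc2
              omega) (s-1) 0 (by omega)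
          (by rw [hu _ (by omega)]; rw [show s - 1 = s + 3 * 1 - 4 by omega]; exact hc.symm)
          (by rw [hu _ (by omega)]; rw [show s - 1 + 1 = s by omega]; exact ha.symm)
          (by rw [hu _ (by omega)]; apply hp.near <;> omega)
          (fun _ => by rw [hu _ (by omega)]; apply hp.near <;> omega)
          (by omega) (by omega) (by omega)
        exact noP w hw
      · exact (one' _ (by omega) (by omega) (by omega)).symm
    · omega

open Finset in
lemma common_ge {V : Type} [DecidableEq V] (G : SimpleGraph V) [DecidableRel G.Adj]
    (U : Finset V) (a b : V) :
    #{u ∈ U | G.Adj a u} + #{u ∈ U | G.Adj b u} ≤ #U + #{u ∈ U | G.Adj a u ∧ G.Adj b u} := by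
  rw [Finset.filter_and, ← Finset.card_union_add_card_inter]
  gcongr
  exact Finset.union_subset (Finset.filter_subset _ _) (Finset.filter_subset _ _)

open Finset in
lemma grow {V : Type} [DecidableEq V] (G : SimpleGraph V) [DecidableRel G.Adj]
    (U : Finset V) (c : ℕ)
    (hc : ∀ a ∈ U, ∀ b ∈ U, G.Adj a b → c ≤ #{u ∈ U | G.Adj a u ∧ G.Adj b u})
    (l : ℕ) (x : ℕ → V) (hx : SP G (l+2) x) (hl : ∀ i < l, x i ∉ U)
    (h0 : x l ∈ U) (h1 : x (l+1) ∈ U) :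
    ∀ k ≤ c, ∃ y, SP G (l+2+k) y ∧ (∀ i < l, y i ∉ U) ∧ (∀ i, l ≤ i → i < l+2+k → y i ∈ U) := by
  intro k
  induction k with
  | zero =>
    intro _
    refine ⟨x, hx, hl, ?_⟩
    intro i hi hi'
    have : i = l ∨ i = l + 1 := by omega
    rcases this with rfl | rfl <;> assumption
  | succ k ih =>
    intro hk
    obtain ⟨y, hy, hyl, hyU⟩ := ih (by omega)
    have hC := hc (y (l+k)) (hyU _ (by omega) (by omega)) (y (l+k+1)) (hyU _ (by omega) (by omega))
      (hy.near _ _ (by omega) (by omega) (by omega) (by omega) (by omega))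
    have hI : #((Finset.Ico l (l+k)).image y) ≤ k := by
      refine Finset.card_image_le.trans ?_
      simp
    obtain ⟨u, hu, hu'⟩ := Finset.exists_mem_notMem_of_card_lt_card
      (lt_of_le_of_lt hI (lt_of_lt_of_le (by omega) hC))
    simp only [Finset.mem_filter] at hu
    have hne : ∀ i < l + 2 + k, y i ≠ u := by
      intro i hi he
      rcases Nat.lt_or_ge i l with h | h
      · exact hyl i h (he ▸ hu.1)
      · rcases Nat.lt_or_ge i (l+k) with h' | h'
        · exact hu' (Finset.mem_image.2 ⟨i, by simp [h, h'], he⟩)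
        · have : i = l + k ∨ i = l + k + 1 := by omega
          rcases this with rfl | rfl
          · exact hu.2.1.ne he
          · exact hu.2.2.ne he
    refine ⟨Function.update y (l+2+k) u, hy.append u hne ?_, ?_, ?_⟩
    · intro i hi hi'
      have : i = l + k ∨ i = l + k + 1 := by omega
      rcases this with rfl | rfl
      · exact hu.2.1
      · exact hu.2.2
    · intro i hi
      rw [Function.update_apply, if_neg (by omega)]
      exact hyl i hi
    · intro i hi hi'
      rw [Function.update_apply]
      split_ifs with h
      · exact hu.1
      · exact hyU i hi (by omega)

open Finset in
def Rst {V : Type} [Fintype V] [DecidableEq V] (t : ℕ) (p : ℕ → V) : Finset V :=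
  univ \ (range t).image p

lemma mem_Rst {V : Type} [Fintype V] [DecidableEq V] (t : ℕ) (p : ℕ → V) (v : V) :
    v ∈ Rst t p ↔ ∀ i < t, p i ≠ v := by
  simp [Rst]

open Finset in
lemma SP.card_Rst {V : Type} [Fintype V] [DecidableEq V] {G : SimpleGraph V} {t : ℕ} {p : ℕ → V}
    (h : SP G t p) : #(Rst t p) + t = Fintype.card V := by
  have h1 : #((range t).image p) = t := by
    rw [Finset.card_image_of_injOn]
    · simp
    · intro i hi j hj; exact h.1 (by simpa using hi) (by simpa using hj)
  have := Finset.card_sdiff_add_card_eq_card (Finset.subset_univ ((range t).image p))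
  rw [h1, Finset.card_univ] at this
  exact this

open Finset in
lemma SP.deg_split {V : Type} [Fintype V] [DecidableEq V] {G : SimpleGraph V} [DecidableRel G.Adj]
    {t : ℕ} {p : ℕ → V} (h : SP G t p) (v : V) :
    #{u ∈ Rst t p | G.Adj v u} + #{i ∈ range t | G.Adj v (p i)} = #{u | G.Adj v u} := by
  have h1 : #{i ∈ range t | G.Adj v (p i)} = #{u ∈ (range t).image p | G.Adj v u} := by
    rw [Finset.filter_image, Finset.card_image_of_injOn]
    intro i hi j hj
    simp only [Finset.coe_filter, Set.mem_ofPred_eq, Finset.mem_range] at hi hj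
    exact h.1 hi.1 hj.1
  rw [h1, Rst, ← Finset.card_union_of_disjoint, ← Finset.filter_union]
  · congr 2
    exact Finset.sdiff_union_of_subset (Finset.subset_univ _)
  · exact Finset.disjoint_filter_filter Finset.sdiff_disjoint

open Finset in
lemma max_ge {V : Type} [Fintype V] [DecidableEq V] [Nonempty V] (G : SimpleGraph V)
    [DecidableRel G.Adj] (t δ : ℕ) (hmax : ∀ t' p', SP G t' p' → t' ≤ t)
    (hd : ∀ v, δ ≤ #{u | G.Adj v u}) (hδ : 1 ≤ δ) : 2 * δ + 2 ≤ Fintype.card V + t := by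
  obtain ⟨a⟩ := ‹Nonempty V›
  obtain ⟨b, hb⟩ := Finset.card_pos.1 (lt_of_lt_of_le hδ (hd a))
  simp only [Finset.mem_filter, Finset.mem_univ, true_and] at hb
  have hx : SP G (0+2) (fun i => if i = 0 then a else b) := by
    refine ⟨?_, ?_, ?_⟩
    · intro i hi j hj hij
      simp only [Set.mem_Iio] at hi hj
      simp only at hij
      split_ifs at hij
      · omega
      · exact absurd hij hb.ne
      · exact absurd hij.symm hb.ne
      · omega
    · intro i hi
      have : i = 0 := by omega
      subst this
      simpa using hb
    · intro i hi; omega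
  obtain ⟨y, hy, -⟩ := grow G univ (2*δ - Fintype.card V) (by
      intro a _ b _ _
      have h1 := common_ge G univ a b
      have h2 := hd a
      have h3 := hd b
      rw [Finset.card_univ] at h1
      omega) 0 _ hx (by omega) (by simp) (by simp) _ le_rfl
  have := hmax _ _ hy
  omega

open Finset in
lemma core {V : Type} [Fintype V] [DecidableEq V] {G : SimpleGraph V} [DecidableRel G.Adj]
    {t : ℕ} {p : ℕ → V} (hp : SP G t p) (hmax : ∀ t' p', SP G t' p' → t' ≤ t) (δ b : ℕ)
    (hd : ∀ v, δ ≤ #{u | G.Adj v u})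
    (hb : ∀ r, (∀ i < t, p i ≠ r) → #{i ∈ range t | G.Adj r (p i)} ≤ b)
    (hnb : Fintype.card V + b ≤ 2 * δ) (l : ℕ) (x : ℕ → V) (hx : SP G l x) (hl : 2 ≤ l)
    (hxp : ∀ i < l, ∃ j < t, x i = p j) (r : V) (hr : ∀ i < t, p i ≠ r)
    (h1 : G.Adj r (x (l-1))) (h2 : G.Adj r (x (l-2))) :
    l + 2 + 2 * δ ≤ Fintype.card V + 2 * b := by
  have hR := hp.card_Rst
  have hrR : r ∈ Rst t p := (mem_Rst t p r).2 hr
  have hxR : ∀ i < l, x i ∉ Rst t p := by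
    intro i hi hc
    obtain ⟨j, hj, e⟩ := hxp i hi
    exact (mem_Rst t p _).1 hc j hj e.symm
  have hxr : ∀ i < l, x i ≠ r := fun i hi he => hxR i hi (he ▸ hrR)
  have hdR : ∀ r ∈ Rst t p, δ ≤ #{u ∈ Rst t p | G.Adj r u} + b := by
    intro r hr
    have := hp.deg_split (G := G) r
    have := hb r ((mem_Rst t p r).1 hr)
    have := hd r
    omega
  have hlast : δ + 1 ≤ #{u ∈ Rst t p | G.Adj (x (l-1)) u} + t := by
    have e1 := hp.deg_split (G := G) (x (l-1))
    have e2 := hd (x (l-1))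
    obtain ⟨j, hj, e⟩ := hxp (l-1) (by omega)
    have : #{i ∈ range t | G.Adj (x (l-1)) (p i)} < #(range t) := by
      apply Finset.card_lt_card
      refine (Finset.ssubset_iff_of_subset (Finset.filter_subset _ _)).2 ⟨j, by simpa using hj, ?_⟩
      intro hc
      rw [Finset.mem_filter, e] at hc
      exact hc.2.ne rfl
    rw [Finset.card_range] at this
    omega
  have hcm := common_ge G (Rst t p) (x (l-1)) r
  have hdr := hdR r hrR
  obtain ⟨r', hr'⟩ : ({u ∈ Rst t p | G.Adj (x (l-1)) u ∧ G.Adj r u} : Finset V).Nonempty := by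
    rw [← Finset.card_pos]
    omega
  simp only [Finset.mem_filter] at hr'
  have hy1 := hx.append r hxr (by
    intro i hi hi'
    have : i = l - 1 ∨ i = l - 2 := by omega
    rcases this with rfl | rfl
    · exact h1.symm
    · exact h2.symm)
  have hy2 := hy1.append r' (by
    intro i hi
    rw [Function.update_apply]
    split_ifs with h
    · exact hr'.2.2.ne
    · intro he
      exact hxR i (by omega) (he ▸ hr'.1)) (by
    intro i hi hi'
    rw [Function.update_apply]
    split_ifs with h
    · exact hr'.2.2
    · have : i = l - 1 := by omega
      subst this
      exact hr'.2.1)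
  obtain ⟨y, hy, -⟩ := grow G (Rst t p) (2 * (δ - b) - (Fintype.card V - t)) (by
      intro a ha b hb _
      have h1 := common_ge G (Rst t p) a b
      have h2 := hdR a ha
      have h3 := hdR b hb
      omega) l _ hy2 (by
        intro i hi
        rw [Function.update_apply, if_neg (by omega), Function.update_apply, if_neg (by omega)]
        exact hxR i hi) (by
        rw [Function.update_apply, if_neg (by omega), Function.update_apply, if_pos rfl]
        exact hrR) (by
        rw [Function.update_apply, if_pos rfl]
        exact hr'.1) _ le_rfl
  have := hmax _ _ hy
  omega

open Finset in
lemma core11 {V : Type} [Fintype V] [DecidableEq V] {G : SimpleGraph V} [DecidableRel G.Adj]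
    {t : ℕ} {p : ℕ → V} (hp : SP G t p) (hmax : ∀ t' p', SP G t' p' → t' ≤ t) (δ b : ℕ)
    (hd : ∀ v, δ ≤ #{u | G.Adj v u})
    (hb : ∀ r, (∀ i < t, p i ≠ r) → #{i ∈ range t | G.Adj r (p i)} ≤ b)
    (hnb : Fintype.card V + b ≤ 2 * δ) (r : V) (hr : ∀ i < t, p i ≠ r) (i : ℕ) (hi : i + 1 < t)
    (h1 : G.Adj r (p i)) (h2 : G.Adj r (p (i+1))) :
    i + 4 + 2 * δ ≤ Fintype.card V + 2 * b ∧ t - i + 2 + 2 * δ ≤ Fintype.card V + 2 * b := by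
  constructor
  · have hx : SP G (i+2) p :=
      ⟨fun c hc d hd' => hp.1 (show c < t by have : c < i + 2 := hc; omega)
        (show d < t by have : d < i + 2 := hd'; omega),
        fun j hj => hp.2.1 j (by omega), fun j hj => hp.2.2 j (by omega)⟩
    have := core hp hmax δ b hd hb hnb (i+2) p hx (by omega) (fun j hj => ⟨j, by omega, rfl⟩) r hr
      h2 h1
    omega
  · have hx := hp.reindex (t - i) (fun j => t - 1 - j) (by intros; omega) (by intros; omega)
      (by intro j hj; apply hp.near <;> omega) (by intro j hj; apply hp.near <;> omega)
    refine core hp hmax δ b hd hb hnb (t-i) _ hx (by omega)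
      (fun j hj => ⟨t - 1 - j, by omega, rfl⟩) r hr ?_ ?_
    · rwa [show t - 1 - (t - i - 1) = i by omega]
    · rwa [show t - 1 - (t - i - 2) = i + 1 by omega]

open Finset in
lemma Opt.two_thirds {V : Type} [DecidableEq V] {G : SimpleGraph V} [DecidableRel G.Adj]
    {t : ℕ} {p : ℕ → V} (h : Opt G t p) (r : V) (hr : ∀ i < t, p i ≠ r) (a b : ℕ) (hab : a ≤ b)
    (hbt : b ≤ t) : 3 * #{i ∈ Ico a b | G.Adj r (p i)} ≤ 2 * (b - a) + 3 :=
  cnt_pattern (fun i => G.Adj r (p i)) t (h.no_pattern r hr) a b hab hbt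

open Finset in
lemma Opt.half {V : Type} [Fintype V] [DecidableEq V] {G : SimpleGraph V} [DecidableRel G.Adj]
    {t : ℕ} {p : ℕ → V} (h : Opt G t p) (δ : ℕ) (hd : ∀ v, δ ≤ #{u | G.Adj v u})
    (hF : 3 * Fintype.card V + 2 * t + 1 ≤ 6 * δ) (ht : 20 ≤ t)
    (r : V) (hr : ∀ i < t, p i ≠ r) :
    2 * #{i ∈ range t | G.Adj r (p i)} ≤ t + 1 := by
  have hp := h.1
  have hmax := h.2.1
  have b1 : ∀ r, (∀ i < t, p i ≠ r) → #{i ∈ range t | G.Adj r (p i)} ≤ (2 * t + 3) / 3 := by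
    intro r hr
    have := h.two_thirds r hr 0 t (by omega) le_rfl
    rw [← Finset.range_eq_Ico] at this
    omega
  have c1 := core11 hp hmax δ _ hd b1 (by omega)
  have b2 : ∀ r, (∀ i < t, p i ≠ r) → #{i ∈ range t | G.Adj r (p i)} ≤ (10 * t + 35) / 18 := by
    intro r hr
    have e1 := cnt_half (fun i => G.Adj r (p i)) 0 (t/3+1) (by omega) (by
      intro i hi hi' h1 h2
      have := c1 r hr i (by omega) h1 h2
      omega)
    have e2 := h.two_thirds r hr (t/3+1) (2*t/3) (by omega) (by omega)
    have e3 := cnt_half (fun i => G.Adj r (p i)) (2*t/3) t (by omega) (by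
      intro i hi hi' h1 h2
      have := c1 r hr i (by omega) h1 h2
      omega)
    have hu : (range t) = (Ico 0 (t/3+1) ∪ Ico (t/3+1) (2*t/3)) ∪ Ico (2*t/3) t := by
      ext i; simp only [Finset.mem_union, Finset.mem_Ico, Finset.mem_range]; omega
    have : #{i ∈ range t | G.Adj r (p i)} ≤ #{i ∈ Ico 0 (t/3+1) | G.Adj r (p i)} +
        #{i ∈ Ico (t/3+1) (2*t/3) | G.Adj r (p i)} + #{i ∈ Ico (2*t/3) t | G.Adj r (p i)} := by
      rw [hu, Finset.filter_union, Finset.filter_union]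
      refine (Finset.card_union_le _ _).trans ?_
      gcongr
      exact Finset.card_union_le _ _
    omega
  have c2 := core11 hp hmax δ _ hd b2 (by omega)
  have e1 := cnt_half (fun i => G.Adj r (p i)) 0 t (by omega) (by
      intro i hi hi' h1 h2
      have := c2 r hr i (by omega) h1 h2
      omega)
  rw [← Finset.range_eq_Ico] at e1
  omega

open Finset in
lemma backpath {V : Type} [Fintype V] [DecidableEq V] {G : SimpleGraph V} [DecidableRel G.Adj]
    {t : ℕ} {p : ℕ → V} (hp : SP G t p) (hmax : ∀ t' p', SP G t' p' → t' ≤ t) (δ b : ℕ)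
    (hd : ∀ v, δ ≤ #{u | G.Adj v u})
    (hb : ∀ r, (∀ i < t, p i ≠ r) → #{i ∈ range t | G.Adj r (p i)} ≤ b)
    (hnb : Fintype.card V + b ≤ 2 * δ) (r : V) (hr : ∀ i < t, p i ≠ r) (j i : ℕ) (hij : j + 2 ≤ i)
    (hi : i < t) (a1 : G.Adj (p j) (p i)) (a2 : G.Adj (p (j+1)) (p i))
    (h1 : G.Adj r (p j)) (h2 : G.Adj r (p i)) :
    i - j + 3 + 2 * δ ≤ Fintype.card V + 2 * b := by
  have hx := hp.reindex (i - j + 1) (fun k => if k < i - j then i - 1 - k else i)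
    (by intro k hk; split_ifs <;> omega)
    (by intro k hk m hm; split_ifs <;> omega)
    (by
      intro k hk
      by_cases e : k + 1 < i - j
      · rw [if_pos (by omega), if_pos e]
        apply hp.near <;> omega
      · rw [if_pos (by omega), if_neg e, show i - 1 - k = j by omega]
        exact a1)
    (by
      intro k hk
      by_cases e : k + 2 < i - j
      · rw [if_pos (by omega), if_pos e]
        apply hp.near <;> omega
      · rw [if_pos (by omega), if_neg e, show i - 1 - k = j + 1 by omega]
        exact a2)
  have := core hp hmax δ b hd hb hnb (i-j+1) _ hx (by omega)
      (fun k hk => ⟨if k < i - j then i - 1 - k else i, by split_ifs <;> omega, rfl⟩) r hr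
      (by
        rw [if_neg (by omega)]
        exact h2)
      (by
        rw [if_pos (by omega), show i - 1 - (i - j + 1 - 2) = j by omega]
        exact h1)
  omega

open Finset in
lemma idx_common (s : Finset ℕ) (P Q : ℕ → Prop) [DecidablePred P] [DecidablePred Q] :
    #{i ∈ s | P i} + #{i ∈ s | Q i} ≤ #s + #{i ∈ s | P i ∧ Q i} := by
  rw [Finset.filter_and, ← Finset.card_union_add_card_inter]
  gcongr
  exact Finset.union_subset (Finset.filter_subset _ _) (Finset.filter_subset _ _)

open Finset in
lemma final {V : Type} [Fintype V] [DecidableEq V] {H : SimpleGraph V} [DecidableRel H.Adj]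
    [Nonempty V]
    {t : ℕ} {p : ℕ → V} (h : Opt H t p) (δ : ℕ) (hd : ∀ v, δ ≤ #{u | H.Adj v u})
    (F1 : 3 * Fintype.card V + 2 * t + 1 ≤ 6 * δ) (F2 : 997 * Fintype.card V ≤ 1500 * δ)
    (hn : 6000 ≤ Fintype.card V) (h2t : 2 * t < Fintype.card V) : False := by
  have hp := h.1
  have hmax := h.2.1
  have ht0 := max_ge H t δ hmax hd (by omega)
  obtain ⟨n, hN⟩ : ∃ n, n = Fintype.card V := ⟨_, rfl⟩
  rw [← hN] at F1 F2 hn h2t ht0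
  have hhalf := h.half δ hd (by omega) (by omega)
  have hb : ∀ r, (∀ i < t, p i ≠ r) → #{i ∈ range t | H.Adj r (p i)} ≤ (t+1)/2 := by
    intro r hr
    have := hhalf r hr
    omega
  have hnb : Fintype.card V + (t+1)/2 ≤ 2 * δ := by omega
  have no11 : ∀ r, (∀ i < t, p i ≠ r) → ∀ i, i + 1 < t → H.Adj r (p i) → ¬ H.Adj r (p (i+1)) := by
    intro r hr i hi h1 h2
    have := core11 hp hmax δ _ hd hb hnb r hr i hi h1 h2
    omega
  have cR := hp.card_Rst
  rw [← hN] at cR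
  obtain ⟨R, hR⟩ : ∃ R, R = Rst t p := ⟨_, rfl⟩
  have memR : ∀ v, v ∈ R ↔ ∀ i < t, p i ≠ v := by intro v; rw [hR]; exact mem_Rst t p v
  have dsp : ∀ v, #{u ∈ R | H.Adj v u} + #{i ∈ range t | H.Adj v (p i)} = #{u | H.Adj v u} := by
    intro v; rw [hR]; exact hp.deg_split v
  rw [← hR] at cR
  obtain ⟨G, adjG⟩ : ∃ G : SimpleGraph {v // v ∈ R}, ∀ a b : {v // v ∈ R}, G.Adj a b ↔ H.Adj a.1 b.1 :=
    ⟨H.comap Subtype.val, fun a b => Iff.rfl⟩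
  have : DecidableRel G.Adj := Classical.decRel _
  have cW : Fintype.card {v // v ∈ R} = #R := Fintype.card_coe R
  have : Nonempty {v // v ∈ R} := by
    rw [← Fintype.card_pos_iff]; omega
  have degG : ∀ w : {v // v ∈ R}, #{u | G.Adj w u} = #{u ∈ R | H.Adj w.1 u} := by
    intro w
    refine Finset.card_bij (fun u _ => u.1) ?_ ?_ ?_
    · intro u hu
      simp only [Finset.mem_filter, Finset.mem_univ, true_and] at hu
      exact Finset.mem_filter.2 ⟨u.2, (adjG _ _).1 hu⟩
    · intro a _ b _ e
      exact Subtype.ext e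
    · intro u hu
      rw [Finset.mem_filter] at hu
      exact ⟨⟨u, hu.1⟩, by simpa using (adjG _ _).2 hu.2, rfl⟩
  have hdG : ∀ w : {v // v ∈ R}, δ - (t+1)/2 ≤ #{u | G.Adj w u} := by
    intro w
    have e1 := degG w
    have e2 := dsp w.1
    have e3 := hb w.1 ((memR w.1).1 w.2)
    have e4 := hd w.1
    omega
  obtain ⟨q, z, hQ⟩ := exists_opt G
  have hqt : q ≤ t := by
    refine hmax q (fun i => (z i).1) ⟨?_, fun i hi => (adjG _ _).1 (hQ.1.2.1 i hi),
      fun i hi => (adjG _ _).1 (hQ.1.2.2 i hi)⟩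
    intro i hi j hj e
    exact hQ.1.1 hi hj (Subtype.ext e)
  have hq0 := max_ge G q _ hQ.2.1 hdG (by omega)
  have cR2 := hQ.1.card_Rst
  rw [cW] at hq0 cR2
  have key : ∀ w : {v // v ∈ R}, (∀ i < q, z i ≠ w) → δ + 1 ≤ #{i ∈ range t | H.Adj w.1 (p i)} +
      #{i ∈ range q | G.Adj w (z i)} + #(Rst q z) := by
    intro w hw
    have e1 := degG w
    have e2 := dsp w.1
    have e4 := hd w.1
    have e5 := hQ.1.deg_split w
    have e6 : #{u ∈ Rst q z | G.Adj w u} < #(Rst q z) := by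
      apply Finset.card_lt_card
      refine (Finset.ssubset_iff_of_subset (Finset.filter_subset _ _)).2
        ⟨w, (mem_Rst q z w).2 hw, ?_⟩
      intro hc
      rw [Finset.mem_filter] at hc
      exact hc.2.ne rfl
    omega
  obtain ⟨w, hw⟩ : (Rst q z).Nonempty := by
    rw [← Finset.card_pos]; omega
  have hw' := (mem_Rst q z w).1 hw
  have hF' : 3 * #R + 2 * q + 1 ≤ 6 * (δ - (t+1)/2) := by
    by_contra hc
    have e1 := key w hw'
    have e2 := hb w.1 ((memR w.1).1 w.2)
    have e3 := hQ.two_thirds w hw' 0 q (by omega) le_rfl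
    rw [← Finset.range_eq_Ico] at e3
    omega
  have hhQ := hQ.half _ hdG (by rw [cW]; exact hF') (by omega)
  have htq : t + q + 2 * δ ≤ 2 * n := by
    have e1 := key w hw'
    have e2 := hhalf w.1 ((memR w.1).1 w.2)
    have e3 := hhQ w hw'
    omega
  have S : ∀ j, j + 1 < t → 2 * δ ≤ n +
      #{i ∈ range t | H.Adj (p j) (p i) ∧ H.Adj (p (j+1)) (p i)} := by
    intro j hj
    have e1 := idx_common (range t) (fun i => H.Adj (p j) (p i)) (fun i => H.Adj (p (j+1)) (p i))
    have e2 := common_ge H R (p j) (p (j+1))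
    have e3 : #{u ∈ R | H.Adj (p j) u ∧ H.Adj (p (j+1)) u} = 0 := by
      rw [Finset.card_eq_zero, Finset.filter_eq_empty_iff]
      rintro u hu ⟨h1, h2⟩
      exact no11 u ((memR u).1 hu) j hj h1.symm h2.symm
    have e4 := dsp (p j)
    have e5 := dsp (p (j+1))
    have e6 := hd (p j)
    have e7 := hd (p (j+1))
    rw [Finset.card_range] at e1
    omega
  have T1 : ∀ j, j + 1 < t → δ + 1 ≤ #{u ∈ R | H.Adj (p j) u} + t := by
    intro j hj
    have e1 := dsp (p j)
    have e2 := hd (p j)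
    have : #{i ∈ range t | H.Adj (p j) (p i)} < #(range t) := by
      apply Finset.card_lt_card
      refine (Finset.ssubset_iff_of_subset (Finset.filter_subset _ _)).2
        ⟨j, by rw [Finset.mem_range]; omega, ?_⟩
      intro hc
      rw [Finset.mem_filter] at hc
      exact hc.2.ne rfl
    rw [Finset.card_range] at this
    omega
  have T2 : ∀ j, j + 1 < t → j ≤ 1 → ∀ u ∈ R, H.Adj (p j) u → ∃ i < q, (z i).1 = u := by
    intro j hj hj1 u hu ha
    by_contra! hc
    have hru := (memR u).1 hu
    have e1 := key ⟨u, hu⟩ (fun i hi e => hc i hi (congrArg Subtype.val e))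
    have e3 := hhQ ⟨u, hu⟩ (fun i hi e => hc i hi (congrArg Subtype.val e))
    have e4 := S j hj
    have e5 : #{i ∈ range t | H.Adj u (p i)} +
        #{i ∈ range t | H.Adj (p j) (p i) ∧ H.Adj (p (j+1)) (p i)} ≤ t + (n + t - 2 * δ + 3) := by
      have f1 := idx_common (range t) (fun i => H.Adj u (p i))
        (fun i => H.Adj (p j) (p i) ∧ H.Adj (p (j+1)) (p i))
      rw [Finset.card_range] at f1
      have f2 : #{i ∈ range t | H.Adj u (p i) ∧ (H.Adj (p j) (p i) ∧ H.Adj (p (j+1)) (p i))} ≤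
          #(range (n + t - 2 * δ + 3)) := by
        apply Finset.card_le_card
        intro i hi
        rw [Finset.mem_filter, Finset.mem_range] at hi
        rw [Finset.mem_range]
        obtain ⟨hi, g1, g2, g3⟩ := hi
        by_cases hij : j + 2 ≤ i
        · have := backpath hp hmax δ _ hd hb hnb u hru j i hij hi g2 g3 ha.symm g1
          omega
        · omega
      rw [Finset.card_range] at f2
      omega
    dsimp only at e1
    omega
  have d0 := T1 0 (by omega)
  have d1 := T1 1 (by omega)
  have e3 : #({u ∈ R | H.Adj (p 0) u} ∪ {u ∈ R | H.Adj (p 1) u}) =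
      #{u ∈ R | H.Adj (p 0) u} + #{u ∈ R | H.Adj (p 1) u} := by
    apply Finset.card_union_of_disjoint
    rw [Finset.disjoint_left]
    intro u h1 h2
    rw [Finset.mem_filter] at h1 h2
    exact no11 u ((memR u).1 h1.1) 0 (by omega) h1.2.symm h2.2.symm
  have e4 : #({u ∈ R | H.Adj (p 0) u} ∪ {u ∈ R | H.Adj (p 1) u}) ≤
      #((range q).image (fun i => (z i).1)) := by
    apply Finset.card_le_card
    intro u hu
    rw [Finset.mem_union, Finset.mem_filter, Finset.mem_filter] at hu
    rw [Finset.mem_image]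
    rcases hu with hu | hu
    · obtain ⟨i, hi, e⟩ := T2 0 (by omega) (by omega) u hu.1 hu.2
      exact ⟨i, Finset.mem_range.2 hi, e⟩
    · obtain ⟨i, hi, e⟩ := T2 1 (by omega) (by omega) u hu.1 hu.2
      exact ⟨i, Finset.mem_range.2 hi, e⟩
  have e5 : #((range q).image (fun i => (z i).1)) ≤ q := by
    refine Finset.card_image_le.trans ?_
    simp
  omega

/-- Path Cover Lemma, part (a): if `δ(H) ≥ (2/3 - ε) n`, `0 < ε ≤ 1/500`, and
`n ≥ 6000`, then `H` has a square path on at least `(1/2 - 3ε) n` vertices. -/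
theorem stmt_7 {V : Type} [Fintype V] [DecidableEq V] (H : SimpleGraph V)
    [DecidableRel H.Adj] (ε : ℝ) (hε0 : 0 < ε) (hε : ε ≤ 1/500)
    (hn : 6000 ≤ Fintype.card V)
    (hδ : (2/3 - ε) * (Fintype.card V : ℝ) ≤ H.minDegree) :
    ∃ (t : ℕ) (p : ℕ → V), Set.InjOn p (Set.Iio t) ∧
      (∀ i, i + 1 < t → H.Adj (p i) (p (i+1))) ∧
      (∀ i, i + 2 < t → H.Adj (p i) (p (i+2))) ∧
      (1/2 - 3*ε) * (Fintype.card V : ℝ) ≤ t := by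
  have : Nonempty V := by
    rw [← Fintype.card_pos_iff]; omega
  obtain ⟨t, p, h⟩ := exists_opt H
  refine ⟨t, p, h.1.1, h.1.2.1, h.1.2.2, ?_⟩
  by_contra hc
  rw [not_le] at hc
  have hnR : (6000 : ℝ) ≤ (Fintype.card V : ℝ) := by exact_mod_cast hn
  have hεn : 0 < ε * (Fintype.card V : ℝ) := by positivity
  have hεn2 : ε * (Fintype.card V : ℝ) ≤ 1/500 * (Fintype.card V : ℝ) := by gcongr
  refine final h H.minDegree ?_ ?_ ?_ hn ?_
  · intro v
    have := H.minDegree_le_degree v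
    rwa [← SimpleGraph.card_neighborFinset_eq_degree, SimpleGraph.neighborFinset_eq_filter] at this
  · have : (3 * Fintype.card V + 2 * t : ℝ) < 6 * H.minDegree := by nlinarith
    have : 3 * Fintype.card V + 2 * t < 6 * H.minDegree := by exact_mod_cast this
    omega
  · have : (997 * Fintype.card V : ℝ) ≤ 1500 * H.minDegree := by nlinarith
    exact_mod_cast this
  · have : (2 * t : ℝ) < Fintype.card V := by nlinarith
    exact_mod_cast this
end

section
/- Let H be a graph on n vertices with δ(H) ≥ (2/3 − ε)n, where 0 < ε ≤ 1/500 and n ≥ 6000. Then H contains two vertex-disjoint square paths P_1 and P_2 with |P_1| + |P_2| > (5/6 − 2ε)n. -/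
namespace SqPath

set_option linter.unusedSectionVars false

variable {V : Type} [DecidableEq V] (H : SimpleGraph V) [DecidableRel H.Adj]

/-- square path predicate on lists -/
def Sq : List V → Prop
  | [] => True
  | a :: l => (∀ x ∈ l.take 2, H.Adj a x) ∧ Sq l

/-- indicator of adjacency -/
def ind (a b : V) : ℕ := if H.Adj a b then 1 else 0

/-- chord weight at a vertex -/
def gw (a : V) : List V → ℕ
  | [_, _, c] => 3 * ind H a c
  | [_, _, c, d] => 3 * ind H a c + ind H a d
  | _ => 0

/-- total chord weight -/
def KW : List V → ℕ
  | [] => 0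
  | a :: l => gw H a (l.take 4) + KW l

variable {H}

theorem Sq_right {A X : List V} (h : Sq H (A ++ X)) : Sq H X := by
  induction A with
  | nil => simpa using h
  | cons a A ih => exact ih h.2

theorem Sq_left {A X : List V} (h : Sq H (A ++ X)) : Sq H A := by
  induction A with
  | nil => trivial
  | cons a A ih =>
    refine ⟨fun x hx => h.1 x ?_, ih h.2⟩
    change x ∈ List.take 2 (A ++ X)
    rw [List.take_append]
    exact List.mem_append_left _ hx

theorem Sq_glue {A X : List V} {a b : V} (h : Sq H (A ++ [a, b])) (h2 : Sq H (a :: b :: X)) :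
    Sq H (A ++ a :: b :: X) := by
  induction A with
  | nil => simpa using h2
  | cons c A ih =>
    refine ⟨?_, ih h.2⟩
    have h1 := h.1
    intro x hx
    apply h1
    rcases A with _ | ⟨d, _ | ⟨e, A⟩⟩ <;> simpa using hx

theorem Sq_reverse_aux {A : List V} {a b c : V} :
    Sq H (A ++ [a, b, c]) ↔ Sq H (A ++ [a, b]) ∧ H.Adj a c ∧ H.Adj b c := by
  constructor
  · intro h
    have h1 : Sq H ((A ++ [a, b]) ++ [c]) := by simpa using h
    refine ⟨Sq_left h1, ?_⟩
    have h2 := Sq_right h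
    simp [Sq] at h2
    tauto
  · rintro ⟨h1, h2, h3⟩
    apply Sq_glue h1
    have := Sq_right h1
    simp [Sq] at this ⊢
    tauto

theorem Sq_reverse {l : List V} (h : Sq H l) : Sq H l.reverse := by
  induction l with
  | nil => trivial
  | cons a l ih =>
    have ih := ih h.2
    have h1 := h.1
    rcases l with _ | ⟨b, _ | ⟨c, l⟩⟩
    · simp [Sq]
    · simp [Sq] at h1 ⊢
      exact h1.symm
    · simp only [List.reverse_cons, List.append_assoc, List.cons_append, List.nil_append] at ih ⊢
      rw [Sq_reverse_aux]
      simp at h1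
      exact ⟨ih, h1.2.symm, h1.1.symm⟩

theorem KW_swap {A X Y : List V} (h : X.take 4 = Y.take 4) :
    KW H (A ++ X) + KW H Y = KW H (A ++ Y) + KW H X := by
  induction A with
  | nil => simp [add_comm]
  | cons a A ih =>
    simp only [List.cons_append, KW]
    have : (A ++ X).take 4 = (A ++ Y).take 4 := by
      rw [List.take_append, List.take_append]
      congr 1
      have := congrArg (List.take (4 - A.length)) h
      rw [List.take_take, List.take_take] at this
      simpa using this
    rw [this]
    omega

variable (H)

/-- optimal square path inside a set -/
structure Opt (S : Finset V) (l : List V) : Prop where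
  nd : l.Nodup
  sq : Sq H l
  sub : ∀ x ∈ l, x ∈ S
  len : ∀ l' : List V, l'.Nodup → Sq H l' → (∀ x ∈ l', x ∈ S) → l'.length ≤ l.length
  wt : ∀ l' : List V, l'.Nodup → Sq H l' → (∀ x ∈ l', x ∈ S) → l'.length = l.length →
    KW H l' ≤ KW H l

variable {H} {S : Finset V} {l : List V} {v : V}

theorem Opt.noins (ho : Opt H S l) (hv : v ∈ S) (hvl : v ∉ l) {l' : List V}
    (hp : l'.Perm (v :: l)) (hs : Sq H l') : False := by
  have h1 : l'.Nodup := hp.nodup_iff.2 (List.nodup_cons.2 ⟨hvl, ho.nd⟩)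
  have h2 := ho.len l' h1 hs (by
    intro x hx
    have := hp.subset hx
    rcases List.mem_cons.1 this with rfl | h
    · exact hv
    · exact ho.sub x h)
  rw [hp.length_eq] at h2
  simp at h2

/-- four consecutive neighbours are impossible -/
theorem Opt.run4 (ho : Opt H S l) (hv : v ∈ S) (hvl : v ∉ l) {A B : List V} {a b c d : V}
    (hl : l = A ++ a :: b :: c :: d :: B) (ha : H.Adj v a) (hb : H.Adj v b) (hc : H.Adj v c)
    (hd : H.Adj v d) : False := by
  subst hl
  have hs := ho.sq
  apply ho.noins hv hvl (l' := A ++ a :: b :: v :: c :: d :: B)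
  · grind
  · have h1 : Sq H (A ++ [a, b]) := by
      apply Sq_left (X := c :: d :: B); simpa using hs
    apply Sq_glue h1
    have h2 := Sq_right hs
    simp [Sq, ha.symm, hb.symm, hc, hd] at h2 ⊢
    tauto

theorem Opt.L1 (ho : Opt H S l) (hv : v ∈ S) (hvl : v ∉ l) {A B : List V}
    {x1 x2 x3 x4 x5 x6 x7 : V}
    (hl : l = A ++ x1 :: x2 :: x3 :: x4 :: x5 :: x6 :: x7 :: B)
    (h1 : H.Adj v x1) (h2 : H.Adj v x2) (h3 : H.Adj v x3) (h5 : H.Adj v x5)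
    (h47 : H.Adj x4 x7) : False := by
  subst hl
  have hs := ho.sq
  apply ho.noins hv hvl (l' := A ++ x1 :: x2 :: v :: x3 :: x5 :: x4 :: x6 :: x7 :: B)
  · grind
  · have h1 : Sq H (A ++ [x1, x2]) := by
      apply Sq_left (X := x3 :: x4 :: x5 :: x6 :: x7 :: B); simpa using hs
    apply Sq_glue h1
    have h2 := Sq_right hs
    simp [Sq] at h2 ⊢
    simp only [H.adj_comm] at *
    grind [H.adj_comm]

theorem Opt.swap (ho : Opt H S l) (hv : v ∈ S) (hvl : v ∉ l) {A B : List V}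
    {x0 x1 x2 x3 x4 x5 x6 x7 x8 : V}
    (hl : l = A ++ x0 :: x1 :: x2 :: x3 :: x4 :: x5 :: x6 :: x7 :: x8 :: B)
    (h2 : H.Adj v x2) (h3 : H.Adj v x3) (h5 : H.Adj v x5) (h6 : H.Adj v x6) :
    ind H x0 v + 3 * ind H x1 v + 3 * ind H v x7 + ind H v x8 ≤
    ind H x0 x4 + 3 * ind H x1 x4 + 3 * ind H x4 x7 + ind H x4 x8 := by
  subst hl
  have hs := ho.sq
  have hnd := ho.nd
  have hsub := ho.sub
  have key := ho.wt (A ++ x0 :: x1 :: x2 :: x3 :: v :: x5 :: x6 :: x7 :: x8 :: B) ?_ ?_ ?_ ?_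
  · have := KW_swap (H := H) (A := A) (X := x0 :: x1 :: x2 :: x3 :: v :: x5 :: x6 :: x7 :: x8 :: B)
      (Y := x0 :: x1 :: x2 :: x3 :: x4 :: x5 :: x6 :: x7 :: x8 :: B) (by simp)
    simp [KW, gw] at this
    omega
  · have hp : (x4 :: (A ++ x0 :: x1 :: x2 :: x3 :: v :: x5 :: x6 :: x7 :: x8 :: B)).Perm
       (v :: (A ++ x0 :: x1 :: x2 :: x3 :: x4 :: x5 :: x6 :: x7 :: x8 :: B)) := by
      grind
    exact (hp.nodup_iff.2 (List.nodup_cons.2 ⟨hvl, hnd⟩)).of_cons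
  · have h1 : Sq H (A ++ [x0, x1]) := by
      apply Sq_left (X := x2 :: x3 :: x4 :: x5 :: x6 :: x7 :: x8 :: B); simpa using hs
    apply Sq_glue h1
    have h2 := Sq_right hs
    simp [Sq] at h2 ⊢
    grind [H.adj_comm]
  · intro x hx
    simp only [List.mem_append, List.mem_cons] at hx hsub
    grind
  · simp

variable (H) in
/-- rearrangement of a prefix ending in two given vertices -/
def MP (C : List V) (a b : V) : Prop :=
  ∃ D : List V, (D ++ [a, b]).Perm C ∧ Sq H (D ++ [a, b])

theorem Opt.L3 (ho : Opt H S l) (hv : v ∈ S) (hvl : v ∉ l) {C B : List V}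
    {x3 x5 x6 x7 x8 x9 x10 : V}
    (hl : l = C ++ x6 :: x7 :: x8 :: x9 :: x10 :: B) (hM : MP H C x3 x5)
    (h56 : H.Adj x5 x6)
    (h3 : H.Adj v x3) (h5 : H.Adj v x5) (h6 : H.Adj v x6) (h8 : H.Adj v x8) :
    ¬ H.Adj x7 x10 := by
  intro h710
  subst hl
  have hs := ho.sq
  obtain ⟨D, hD, hD2⟩ := hM
  apply ho.noins hv hvl (l' := D ++ x3 :: x5 :: v :: x6 :: x8 :: x7 :: x9 :: x10 :: B)
  · have hp : (D ++ [x3, x5] ++ v :: x6 :: x8 :: x7 :: x9 :: x10 :: B).Perm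
      (C ++ v :: x6 :: x8 :: x7 :: x9 :: x10 :: B) := hD.append_right _
    have h2 : (C ++ v :: x6 :: x8 :: x7 :: x9 :: x10 :: B).Perm
      (v :: (C ++ x6 :: x7 :: x8 :: x9 :: x10 :: B)) := by grind
    have := hp.trans h2
    simpa using this
  · apply Sq_glue hD2
    have h0 := Sq_right hD2
    have h2 := Sq_right hs
    simp [Sq] at h0 h2 ⊢
    grind [H.adj_comm]

theorem permA (A0 : List V) (x0 x1 x2 x3 x4 y1 : V) :
    (A0 ++ [x0, x1, x2, x4] ++ [x3, y1]).Perm (A0 ++ [x0, x1, x2] ++ [x3, x4, y1]) := by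
  simp only [List.append_assoc, List.cons_append, List.nil_append]
  exact ((List.Perm.swap x3 x4 [y1]).cons x2 |>.cons x1 |>.cons x0).append_left A0

theorem permB (A0 : List V) (x7 x6 y1 : V) :
    (A0 ++ [x7, x6, y1]).Perm (A0 ++ [x6, x7, y1]) :=
  (List.Perm.swap x6 x7 [y1]).append_left A0

set_option maxHeartbeats 1000000 in
theorem Opt.scan (ho : Opt H S l) (hv : v ∈ S) (hvl : v ∉ l) (n : ℕ) : ∀ s A T : List V,
    s.length ≤ n → l = A ++ s ++ T → A ≠ [] →
    (3 * s.countP (fun x => H.Adj v x) ≤ 2 * s.length + 4) ∧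
    (∀ A0 x0 x1 x2 x3 x4, A = A0 ++ [x0, x1, x2, x3, x4] → H.Adj v x1 → H.Adj v x2 → H.Adj v x3 →
      ¬ H.Adj v x4 → 3 * s.countP (fun x => H.Adj v x) ≤ 2 * s.length + 3) ∧
    (∀ A0 x3 x4 x5 x6 x7, A = A0 ++ [x3, x4, x5, x6, x7] → H.Adj v x3 → ¬ H.Adj v x4 → H.Adj v x5 →
      H.Adj v x6 → ¬ H.Adj v x7 → ¬ H.Adj x4 x7 →
      (∀ y s', s = y :: s' → H.Adj v y → MP H (A0 ++ [x3, x4, x5]) x3 x5) →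
      3 * s.countP (fun x => H.Adj v x) ≤ 2 * s.length + 3) := by
  induction n with
  | zero =>
    intro s A T hs
    have : s = [] := by simpa using hs
    subst this
    simp
  | succ n ih =>
    intro s A T hsn hl hA
    by_cases hlen : s.length ≤ 3
    · have := List.countP_le_length (p := fun x => decide (H.Adj v x)) (l := s)
      refine ⟨by omega, fun _ _ _ _ _ _ _ _ _ _ _ => by omega,
        fun _ _ _ _ _ _ _ _ _ _ _ _ _ _ => by omega⟩
    obtain ⟨y1, y2, y3, y4, s, rfl⟩ : ∃ y1 y2 y3 y4 s', s = y1 :: y2 :: y3 :: y4 :: s' := by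
      rcases s with _ | ⟨y1, _ | ⟨y2, _ | ⟨y3, _ | ⟨y4, s⟩⟩⟩⟩
      · simp at hlen
      · simp at hlen
      · simp at hlen
      · simp at hlen
      · exact ⟨_, _, _, _, _, rfl⟩
    simp only [List.length_cons] at hsn
    have I1 := ih (y2 :: y3 :: y4 :: s) (A ++ [y1]) T (by simp; omega) (by simp [hl]) (by simp)
    have I2 := ih (y3 :: y4 :: s) (A ++ [y1, y2]) T (by simp; omega) (by simp [hl]) (by simp)
    have I3 := ih (y4 :: s) (A ++ [y1, y2, y3]) T (by simp; omega) (by simp [hl]) (by simp)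
    have I4 := ih s (A ++ [y1, y2, y3, y4]) T (by omega) (by simp [hl]) (by simp)
    refine ⟨?_, ?_, ?_⟩
    · by_cases h1 : H.Adj v y1
      swap
      · have := I1.1
        simp [List.countP_cons, h1] at this ⊢
        omega
      by_cases h2 : H.Adj v y2
      swap
      · have := I2.1
        simp [List.countP_cons, h1, h2] at this ⊢
        omega
      by_cases h3 : H.Adj v y3
      swap
      · have := I3.1
        simp [List.countP_cons, h1, h2, h3] at this ⊢
        omega
      by_cases h4 : H.Adj v y4
      · exact (ho.run4 hv hvl (A := A) (B := s ++ T) (by simpa using hl) h1 h2 h3 h4).elim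
      · obtain ⟨A0, x0, rfl⟩ : ∃ A0 x0, A = A0 ++ [x0] :=
          ⟨A.dropLast, A.getLast hA, (List.dropLast_append_getLast hA).symm⟩
        have := I4.2.1 A0 x0 y1 y2 y3 y4 (by simp) h1 h2 h3 h4
        simp [List.countP_cons, h1, h2, h3, h4] at this ⊢
        omega
    · intro A0 x0 x1 x2 x3 x4 hAe h1 h2 h3 h4
      subst hAe
      by_cases h5 : H.Adj v y1
      swap
      · have := I1.1
        simp [List.countP_cons, h5] at this ⊢
        omega
      by_cases h6 : H.Adj v y2
      swap
      · have := I2.1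
        simp [List.countP_cons, h5, h6] at this ⊢
        omega
      have h47 : ¬ H.Adj x4 y3 := fun h =>
        ho.L1 hv hvl (A := A0 ++ [x0]) (B := y4 :: s ++ T) (by simpa using hl) h1 h2 h3 h5 h
      have hsw := ho.swap hv hvl (A := A0) (B := s ++ T) (by simpa using hl) h2 h3 h5 h6
      have h7 : ¬ H.Adj v y3 := by
        intro h7
        simp only [ind, h1.symm, h7, h47, if_true, if_false] at hsw
        split_ifs at hsw <;> omega
      have h14 : H.Adj x1 x4 := by
        by_contra h14
        simp only [ind, h1.symm, h7, h47, h14, if_true, if_false] at hsw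
        split_ifs at hsw <;> omega
      have := I3.2.2 (A0 ++ [x0, x1, x2]) x3 x4 y1 y2 y3 (by simp) h3 h4 h5 h6 h7 h47 (by
        intro _ _ _ _
        refine ⟨A0 ++ [x0, x1, x2, x4], permA _ _ _ _ _ _ _, ?_⟩
        have hs : Sq H (A0 ++ x0 :: x1 :: x2 :: x3 :: x4 :: y1 :: y2 :: (y3 :: y4 :: s ++ T)) := by
          have := ho.sq
          rw [hl] at this
          simpa using this
        have h1 : Sq H (A0 ++ [x0, x1]) := by
          apply Sq_left (X := x2 :: x3 :: x4 :: y1 :: y2 :: (y3 :: y4 :: s ++ T)); simpa using hs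
        have h2 := Sq_right hs
        have := Sq_glue h1 (X := [x2, x4, x3, y1]) (by
          simp [Sq] at h2 ⊢
          grind [H.adj_comm])
        simpa using this)
      simp [List.countP_cons, h5, h6, h7] at this ⊢
      omega
    · intro A0 x3 x4 x5 x6 x7 hAe h3 h4 h5 h6 h7 h47 hM
      subst hAe
      by_cases h8 : H.Adj v y1
      swap
      · have := I1.1
        simp [List.countP_cons, h8] at this ⊢
        omega
      by_cases h9 : H.Adj v y2
      swap
      · have := I2.1
        simp [List.countP_cons, h8, h9] at this ⊢
        omega
      have hs : Sq H (A0 ++ x3 :: x4 :: x5 :: x6 :: x7 :: y1 :: y2 :: (y3 :: y4 :: s ++ T)) := by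
        have := ho.sq
        rw [hl] at this
        simpa using this
      have hs2 := Sq_right hs
      have hM := hM _ _ rfl h8
      have h710 : ¬ H.Adj x7 y3 :=
        ho.L3 hv hvl (C := A0 ++ [x3, x4, x5]) (B := y4 :: s ++ T) (by simpa using hl) hM
          (by simp [Sq] at hs2; tauto) h3 h5 h6 h8
      have hsw := ho.swap hv hvl (A := A0) (B := s ++ T) (by simpa using hl) h5 h6 h8 h9
      have h4' : ¬ H.Adj x4 v := fun h => h4 h.symm
      have h10 : ¬ H.Adj v y3 := by
        intro h10
        simp only [ind, h3.symm, h4', h10, h47, h710, if_true, if_false] at hsw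
        split_ifs at hsw <;> omega
      have := I3.2.2 (A0 ++ [x3, x4, x5]) x6 x7 y1 y2 y3 (by simp) h6 h7 h8 h9 h10 h710 (by
        intro y s' hy h11
        obtain ⟨rfl, rfl⟩ : y4 = y ∧ s = s' := by simpa using hy
        have h37 : H.Adj x3 x7 := by
          by_contra h37
          simp only [ind, h3.symm, h4', h10, h47, h710, h11, h37, if_true, if_false] at hsw
          split_ifs at hsw <;> omega
        obtain ⟨D, hD, hD2⟩ := hM
        refine ⟨D ++ [x3, x5, x7], ?_, ?_⟩
        · have hp := hD.append_right [x7, x6, y1]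
          have h2 : (A0 ++ [x3, x4, x5] ++ [x7, x6, y1]).Perm
            (A0 ++ [x3, x4, x5] ++ [x6, x7, y1]) := permB _ _ _ _
          simpa using hp.trans h2
        · have h0 := Sq_right hD2
          have := Sq_glue hD2 (X := [x7, x6, y1]) (by
            simp [Sq] at h0 hs2 ⊢
            grind [H.adj_comm])
          simpa using this)
      simp [List.countP_cons, h8, h9, h10] at this ⊢
      omega


theorem Opt.vert (ho : Opt H S l) (hv : v ∈ S) (hvl : v ∉ l) :
    3 * l.countP (fun x => H.Adj v x) ≤ 2 * l.length + 5 := by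
  rcases hle : l with _ | ⟨a, s⟩
  · simp
  · have := (ho.scan hv hvl s.length s [a] [] le_rfl (by simp [hle]) (by simp)).1
    have h2 : (a :: s).countP (fun x => decide (H.Adj v x)) ≤
        s.countP (fun x => decide (H.Adj v x)) + 1 := by
      rw [List.countP_cons]; split_ifs <;> omega
    simp only [List.length_cons]
    omega

variable (H) in
/-- a square path inside `L` starting with `x`, `y` with at least `q` vertices -/
def Ext (L : Finset V) (q : ℕ) (x y : V) : Prop :=
  ∃ Q : List V, (x :: y :: Q).Nodup ∧ Sq H (x :: y :: Q) ∧ (∀ z ∈ x :: y :: Q, z ∈ L) ∧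
    q ≤ (x :: y :: Q).length

theorem noext {L : Finset V} {q : ℕ} {x y a b : V} {A B : List V}
    (hnd : l.Nodup) (hsq : Sq H l) (hsub : ∀ z ∈ l, z ∈ S)
    (hmax : ∀ l' : List V, l'.Nodup → Sq H l' → (∀ z ∈ l', z ∈ S) → l'.length ≤ l.length)
    (hLS : L ⊆ S) (hLl : ∀ z ∈ L, z ∉ l) (hE : Ext H L q x y) (hl : l = A ++ a :: b :: B)
    (hB : B.length < q) (hax : H.Adj a x) (hbx : H.Adj b x) (hby : H.Adj b y) : False := by
  obtain ⟨Q, h1, h2, h3, h4⟩ := hE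
  subst hl
  have hh := hmax (A ++ a :: b :: x :: y :: Q) ?_ ?_ ?_
  · simp at hh h4
    omega
  · have hd : (A ++ [a, b]).Nodup := by
      have : (A ++ [a, b] ++ B).Nodup := by simpa using hnd
      exact (List.nodup_append.1 this).1
    have : (A ++ [a, b] ++ x :: y :: Q).Nodup := by
      rw [List.nodup_append]
      refine ⟨hd, h1, ?_⟩
      intro c hc d hd' hcd
      subst hcd
      apply hLl c (h3 c hd')
      simp at hc ⊢
      tauto
    simpa using this
  · have hd : Sq H (A ++ [a, b]) := by
      apply Sq_left (X := B); simpa using hsq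
    apply Sq_glue hd
    have := Sq_right hd
    simp [Sq] at this h2 ⊢
    tauto
  · intro z hz
    have : z ∈ A ++ a :: b :: B ∨ z ∈ x :: y :: Q := by
      simp at hz ⊢
      tauto
    rcases this with h | h
    · exact hsub z h
    · exact hLS (h3 z h)

theorem endcount {L : Finset V} {q : ℕ} {x y : V}
    (hnd : l.Nodup) (hsq : Sq H l) (hsub : ∀ z ∈ l, z ∈ S)
    (hmax : ∀ l' : List V, l'.Nodup → Sq H l' → (∀ z ∈ l', z ∈ S) → l'.length ≤ l.length)
    (hLS : L ⊆ S) (hLl : ∀ z ∈ L, z ∉ l) (hE : Ext H L q x y) (hE' : Ext H L q y x) :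
    ∀ s A : List V, l = A ++ s → s.length ≤ q →
    (s.countP (fun z => H.Adj x z) + s.countP (fun z => H.Adj y z) ≤ s.length + 1) ∧
    (∀ a s', s = a :: s' → ¬ (H.Adj x a ∧ H.Adj y a) →
      s.countP (fun z => H.Adj x z) + s.countP (fun z => H.Adj y z) ≤ s.length) := by
  intro s
  induction s with
  | nil => intro A _ _; simp
  | cons a s ih =>
    intro A hl hq
    have ih := ih (A ++ [a]) (by simp [hl]) (by simp at hq; omega)
    rcases s with _ | ⟨b, s⟩
    · by_cases h1 : H.Adj x a <;> by_cases h2 : H.Adj y a <;> simp [h1, h2]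
    · have hb := ih.2 b s rfl
      have ih := ih.1
      have hlen : s.length < q := by simp at hq; omega
      have k1 : H.Adj x a → H.Adj x b → H.Adj y b → False := fun p1 p2 p3 =>
        noext hnd hsq hsub hmax hLS hLl hE hl hlen p1.symm p2.symm p3.symm
      have k2 : H.Adj y a → H.Adj x b → H.Adj y b → False := fun p1 p2 p3 =>
        noext hnd hsq hsub hmax hLS hLl hE' hl hlen p1.symm p3.symm p2.symm
      rw [List.countP_cons (l := b :: s), List.countP_cons (l := b :: s)]
      simp only [List.length_cons] at *
      by_cases h1 : H.Adj x a <;> by_cases h2 : H.Adj y a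
      · have := hb (fun h => k1 h1 h.1 h.2)
        simp [h1, h2]
        omega
      · have := hb (fun h => k1 h1 h.1 h.2)
        simp [h1, h2]
        omega
      · have := hb (fun h => k2 h2 h.1 h.2)
        simp [h1, h2]
        omega
      · simp [h1, h2]
        omega

theorem Opt.edge (ho : Opt H S l) {L : Finset V} {q : ℕ} {x y : V} (hx : x ∈ L) (hy : y ∈ L)
    (hq : 1 ≤ q)
    (hLS : L ⊆ S) (hLl : ∀ z ∈ L, z ∉ l) (hE : Ext H L q x y) (hE' : Ext H L q y x) :
    3 * (l.countP (fun z => H.Adj x z) + l.countP (fun z => H.Adj y z)) +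
      2 * min q (l.length / 2) ≤ 4 * l.length + 14 := by
  have hsuf := endcount (S := S) ho.nd ho.sq ho.sub ho.len hLS hLl hE hE'
  have hpre := endcount (S := S) (l := l.reverse) (List.nodup_reverse.2 ho.nd) (Sq_reverse ho.sq)
    (by simpa using ho.sub) (by simpa using ho.len) hLS (by simpa using hLl) hE hE'
  have hfirst : ∀ F M : List V, l = F ++ M → F.length ≤ q →
      F.countP (fun z => H.Adj x z) + F.countP (fun z => H.Adj y z) ≤ F.length + 1 := by
    intro F M hl hF
    have := (hpre F.reverse M.reverse (by simp [hl]) (by simpa using hF)).1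
    simpa using this
  by_cases h2 : 2 * q ≤ l.length
  · obtain ⟨F, M, E, hl, hF, hE⟩ : ∃ F M E : List V, l = F ++ M ++ E ∧ F.length = q ∧ E.length = q := by
      refine ⟨l.take q, (l.drop q).take (l.length - 2 * q), (l.drop q).drop (l.length - 2 * q), ?_, ?_, ?_⟩
      · simp only [List.append_assoc, List.take_append_drop]
      · simp; omega
      · simp; omega
    have e1 := hfirst F (M ++ E) (by simp [hl]) hF.le
    have e2 := (hsuf E (F ++ M) hl hE.le).1
    have hF0 : F ≠ [] := by rintro rfl; simp at hF; omega
    have e3 := (ho.scan (hLS hx) (hLl x hx) M.length M F E le_rfl hl hF0).1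
    have e4 := (ho.scan (hLS hy) (hLl y hy) M.length M F E le_rfl hl hF0).1
    have e5 : l.length = F.length + M.length + E.length := by rw [hl]; simp; omega
    have e6 : min q (l.length / 2) ≤ q := min_le_left _ _
    have c1 : ∀ u, l.countP (fun z => decide (H.Adj u z)) = F.countP (fun z => decide (H.Adj u z)) +
        M.countP (fun z => decide (H.Adj u z)) + E.countP (fun z => decide (H.Adj u z)) := by
      intro u; rw [hl]; simp only [List.countP_append]
    rw [c1, c1]
    omega
  · have e1 := hfirst (l.take (l.length / 2)) (l.drop (l.length / 2)) (by simp) (by simp; omega)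
    have e2 := (hsuf (l.drop (l.length / 2)) (l.take (l.length / 2)) (by simp) (by simp; omega)).1
    have c1 : ∀ u, l.countP (fun z => decide (H.Adj u z)) =
        (l.take (l.length / 2)).countP (fun z => decide (H.Adj u z)) +
        (l.drop (l.length / 2)).countP (fun z => decide (H.Adj u z)) := by
      intro u; rw [← List.countP_append, List.take_append_drop]
    rw [c1, c1]
    have e6 : min q (l.length / 2) ≤ l.length / 2 := min_le_right _ _
    simp only [List.length_take, List.length_drop] at e1 e2
    omega


theorem gw_le (a : V) (l : List V) : gw H a l ≤ 4 := by
  unfold gw ind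
  split <;> (repeat' split) <;> omega

theorem KW_le (l : List V) : KW H l ≤ 4 * l.length := by
  induction l with
  | nil => simp [KW]
  | cons a l ih =>
    have := gw_le (H := H) a (l.take 4)
    simp only [KW, List.length_cons]; omega

theorem exists_pair [Fintype V] : ∃ l1 l2 : List V,
    Opt H (Finset.univ \ l2.toFinset) l1 ∧ Opt H (Finset.univ \ l1.toFinset) l2 := by
  classical
  set n := Fintype.card V with hn
  let P : List V → List V → Prop := fun l1 l2 =>
    l1.Nodup ∧ Sq H l1 ∧ l2.Nodup ∧ Sq H l2 ∧ ∀ x ∈ l1, x ∉ l2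
  let f : List V → List V → ℕ := fun l1 l2 =>
    (l1.length + l2.length) * (8 * n + 1) + KW H l1 + KW H l2
  have hlen : ∀ l : List V, l.Nodup → l.length ≤ n := fun l h => h.length_le_card
  let T : Set ℕ := {k | ∃ l1 l2, P l1 l2 ∧ f l1 l2 = k}
  have hne : T.Nonempty := ⟨_, [], [], by simp [P, Sq], rfl⟩
  have hb : BddAbove T := by
    refine ⟨(n + n) * (8 * n + 1) + 4 * n + 4 * n, ?_⟩
    rintro k ⟨l1, l2, ⟨h1, -, h2, -, -⟩, rfl⟩
    have := hlen _ h1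
    have := hlen _ h2
    have := KW_le (H := H) l1
    have := KW_le (H := H) l2
    have : (l1.length + l2.length) * (8 * n + 1) ≤ (n + n) * (8 * n + 1) :=
      Nat.mul_le_mul_right _ (by omega)
    simp only [f]
    omega
  obtain ⟨l1, l2, ⟨n1, s1, n2, s2, hd⟩, hf⟩ := Nat.sSup_mem hne hb
  have hmax : ∀ l1' l2', P l1' l2' → f l1' l2' ≤ f l1 l2 := fun a b h => by
    rw [hf]; exact le_csSup hb ⟨a, b, h, rfl⟩
  have key : ∀ l1' l2', P l1' l2' → l1'.length + l2'.length ≤ l1.length + l2.length ∧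
      (l1'.length + l2'.length = l1.length + l2.length →
        KW H l1' + KW H l2' ≤ KW H l1 + KW H l2) := by
    intro a b h
    have h0 := hmax a b h
    have := hlen _ n1
    have := hlen _ n2
    have := KW_le (H := H) l1
    have := KW_le (H := H) l2
    simp only [f] at h0
    constructor
    · by_contra hc
      have : (l1.length + l2.length + 1) * (8 * n + 1) ≤ (a.length + b.length) * (8 * n + 1) :=
        Nat.mul_le_mul_right _ (by omega)
      have h3 : (l1.length + l2.length + 1) * (8 * n + 1) =
        (l1.length + l2.length) * (8 * n + 1) + (8 * n + 1) := by ring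
      omega
    · intro he
      rw [he] at h0; omega
  refine ⟨l1, l2, ⟨n1, s1, ?_, ?_, ?_⟩, ⟨n2, s2, ?_, ?_, ?_⟩⟩
  · intro x hx; simpa using hd x hx
  · intro l' a b c
    have := (key l' l2 ⟨a, b, n2, s2, fun x hx => by simpa using c x hx⟩).1
    omega
  · intro l' a b c d
    have := (key l' l2 ⟨a, b, n2, s2, fun x hx => by simpa using c x hx⟩).2 (by omega)
    omega
  · intro x hx; simp; exact fun h => hd x h hx
  · intro l' a b c
    have := (key l1 l' ⟨n1, s1, a, b, fun x hx hx' => by simpa [hx] using c x hx'⟩).1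
    omega
  · intro l' a b c d
    have := (key l1 l' ⟨n1, s1, a, b, fun x hx hx' => by simpa [hx] using c x hx'⟩).2 (by omega)
    omega

/-- number of neighbours in a set -/
def dL (H : SimpleGraph V) [DecidableRel H.Adj] (L : Finset V) (x : V) : ℕ :=
  (L.filter (fun z => H.Adj x z)).card

/-- common neighbours in a set -/
def cm (H : SimpleGraph V) [DecidableRel H.Adj] (L : Finset V) (x y : V) : Finset V :=
  L.filter (fun z => H.Adj x z ∧ H.Adj y z)

theorem mem_cm {L : Finset V} {x y z : V} :
    z ∈ cm H L x y ↔ z ∈ L ∧ H.Adj x z ∧ H.Adj y z := by simp [cm]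

theorem cm_card (L : Finset V) (x y : V) :
    dL H L x + dL H L y ≤ (cm H L x y).card + L.card := by
  unfold dL cm
  rw [← Finset.card_union_add_card_inter, Finset.filter_and, add_comm]
  gcongr
  intro z; simp; tauto

theorem countP_eq (hl : l.Nodup) (x : V) :
    l.countP (fun z => H.Adj x z) = dL H l.toFinset x := by
  unfold dL
  rw [List.countP_eq_length_filter, ← List.toFinset_card_of_nodup (hl.filter _)]
  congr 1
  ext z; simp

theorem dL_le (L : Finset V) (x : V) : dL H L x ≤ L.card := Finset.card_filter_le _ _

theorem deg_split [Fintype V] {l1 l2 : List V}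
    (o1 : Opt H (Finset.univ \ l2.toFinset) l1) (o2 : Opt H (Finset.univ \ l1.toFinset) l2) (x : V) :
    H.degree x = dL H (Finset.univ \ (l1.toFinset ∪ l2.toFinset)) x +
      l1.countP (fun z => H.Adj x z) + l2.countP (fun z => H.Adj x z) := by
  rw [countP_eq o1.nd, countP_eq o2.nd]
  have hd : ∀ z ∈ l1, z ∉ l2 := fun z hz => by simpa using o1.sub z hz
  unfold dL
  rw [← Finset.card_union_of_disjoint, ← Finset.card_union_of_disjoint, ← H.card_neighborFinset_eq_degree]
  · congr 1
    ext z; simp; tauto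
  · rw [Finset.disjoint_left]; intro z; simp; intro h h1 h2
    rcases h with h | h
    · exact absurd h2 (by tauto)
    · exact absurd h1 (hd z h.1)
  · rw [Finset.disjoint_left]; intro z; simp; tauto

theorem card_split [Fintype V] {l1 l2 : List V}
    (o1 : Opt H (Finset.univ \ l2.toFinset) l1) (o2 : Opt H (Finset.univ \ l1.toFinset) l2) :
    (Finset.univ \ (l1.toFinset ∪ l2.toFinset)).card + l1.length + l2.length = Fintype.card V := by
  have hd : ∀ z ∈ l1, z ∉ l2 := fun z hz => by simpa using o1.sub z hz
  have := Finset.card_sdiff_add_card_eq_card (Finset.subset_univ (l1.toFinset ∪ l2.toFinset))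
  rw [Finset.card_union_of_disjoint, List.toFinset_card_of_nodup o1.nd,
    List.toFinset_card_of_nodup o2.nd, Finset.card_univ] at this
  · omega
  · rw [Finset.disjoint_left]; intro z; simpa using hd z

theorem Sq_cons {x y z : V} {Q : List V} (h : Sq H (x :: y :: Q)) (hx : H.Adj x z) (hy : H.Adj y z) :
    Sq H (z :: x :: y :: Q) := by
  refine ⟨?_, h⟩
  intro w hw
  simp at hw
  rcases hw with rfl | rfl
  · exact hx.symm
  · exact hy.symm

theorem Sq_pair {x y : V} (h : H.Adj x y) : Sq H [x, y] := by
  simp [Sq, h]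

/-- an element of a set not in a list -/
theorem exists_unused (A : Finset V) (U : List V) (h : U.length < A.card) : ∃ z ∈ A, z ∉ U := by
  by_contra hc
  push Not at hc
  have : A ⊆ U.toFinset := fun z hz => by simpa using hc z hz
  have h1 := Finset.card_le_card this
  have h2 := List.toFinset_card_le U
  omega

theorem Ext_step {L : Finset V} {m : ℕ} (hm : 2 ≤ m)
    (hc : ∀ x ∈ L, ∀ y ∈ L, H.Adj x y → m < (cm H L x y).card) {x y : V}
    (h : Ext H L m x y) : Ext H L (m + 1) x y := by
  obtain ⟨Q, nd, sq, sub, len⟩ := h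
  by_cases hl : m + 1 ≤ (x :: y :: Q).length
  · exact ⟨Q, nd, sq, sub, hl⟩
  have hr : ∃ u w R, (x :: y :: Q).reverse = u :: w :: R := by
    have : (x :: y :: Q).reverse.length = m := by rw [List.length_reverse]; omega
    match hh : (x :: y :: Q).reverse, this with
    | [], h => simp at h; omega
    | [a], h => simp at h; omega
    | a :: b :: R, _ => exact ⟨a, b, R, rfl⟩
  obtain ⟨u, w, R, hr⟩ := hr
  have sq' := Sq_reverse sq
  rw [hr] at sq'
  have hmem : ∀ z, z ∈ x :: y :: Q ↔ z ∈ u :: w :: R := fun z => by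
    rw [← hr, List.mem_reverse]
  have hu : u ∈ L := sub u ((hmem u).2 (by simp))
  have hw : w ∈ L := sub w ((hmem w).2 (by simp))
  have huw : H.Adj u w := sq'.1 w (by simp)
  obtain ⟨z, hz, hzU⟩ := exists_unused (cm H L u w) (x :: y :: Q) (by
    have := hc u hu w hw huw; omega)
  rw [mem_cm] at hz
  have sq2 := Sq_reverse (Sq_cons sq' hz.2.1 hz.2.2)
  rw [← hr, List.reverse_cons, List.reverse_reverse] at sq2
  refine ⟨Q ++ [z], ?_, sq2, ?_, ?_⟩
  · have : ((x :: y :: Q) ++ [z]).Nodup := by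
      rw [List.nodup_append]
      refine ⟨nd, by simp, ?_⟩
      intro a ha b hb hab
      simp at hb
      exact hzU (hb ▸ hab ▸ ha)
    exact this
  · intro a ha
    have ha' : a ∈ (x :: y :: Q) ++ [z] := ha
    rw [List.mem_append] at ha'
    rcases ha' with ha' | ha'
    · exact sub a ha'
    · simp at ha'; exact ha' ▸ hz.1
  · simp at len ⊢; omega

theorem Ext_max {L : Finset V} {x0 y0 : V} (hx0 : x0 ∈ L) (hy0 : y0 ∈ L) (h0 : H.Adj x0 y0) :
    ∃ m, 2 ≤ m ∧ (∀ x ∈ L, ∀ y ∈ L, H.Adj x y → Ext H L m x y) ∧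
      ∃ x ∈ L, ∃ y ∈ L, H.Adj x y ∧ (cm H L x y).card ≤ m := by
  by_contra hcon
  push Not at hcon
  have hall : ∀ k, ∀ x ∈ L, ∀ y ∈ L, H.Adj x y → Ext H L (k + 2) x y := by
    intro k
    induction k with
    | zero =>
      intro x hx y hy h
      exact ⟨[], by simp [h.ne], Sq_pair h, by simp [hx, hy], by simp⟩
    | succ k ih =>
      intro x hx y hy h
      exact Ext_step (by omega) (hcon (k + 2) (by omega) ih) (ih x hx y hy h)
  obtain ⟨Q, nd, -, sub, len⟩ := hall L.card x0 hx0 y0 hy0 h0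
  have h1 : (x0 :: y0 :: Q).toFinset ⊆ L := fun z hz => sub z (by simpa using hz)
  have h2 := Finset.card_le_card h1
  rw [List.toFinset_card_of_nodup nd] at h2
  omega

theorem edge_ineq [Fintype V] {l1 l2 : List V} {L : Finset V} {D m : ℕ}
    (o1 : Opt H (Finset.univ \ l2.toFinset) l1) (o2 : Opt H (Finset.univ \ l1.toFinset) l2)
    (hL : L = Finset.univ \ (l1.toFinset ∪ l2.toFinset))
    (hD : ∀ x, D ≤ H.degree x) (hm : 2 ≤ m)
    (hE : ∀ x ∈ L, ∀ y ∈ L, H.Adj x y → Ext H L m x y)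
    {x y : V} (hx : x ∈ L) (hy : y ∈ L) (h : H.Adj x y) :
    6 * D + 2 * min m (l1.length / 2) + 2 * min m (l2.length / 2) ≤
      4 * (l1.length + l2.length) + 28 + 3 * L.card + 3 * (cm H L x y).card := by
  have e1 := o1.edge (L := L) (q := m) hx hy (by omega) (by subst hL; intro z; simp)
    (by subst hL; intro z; simp; tauto) (hE x hx y hy h) (hE y hy x hx h.symm)
  have e2 := o2.edge (L := L) (q := m) hx hy (by omega) (by subst hL; intro z; simp; tauto)
    (by subst hL; intro z; simp) (hE x hx y hy h) (hE y hy x hx h.symm)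
  have d1 := deg_split o1 o2 x
  have d2 := deg_split o1 o2 y
  rw [← hL] at d1 d2
  have := hD x
  have := hD y
  have := cm_card (H := H) L x y
  omega

theorem final_case (ho : Opt H S l) {L R : Finset V} {W : ℕ} (hLS : L ⊆ S) (hLl : ∀ z ∈ L, z ∉ l)
    (hR : ∀ z ∈ R, z ∈ l) (hRc : W + 1 ≤ R.card)
    (hrich : ∀ o ∈ R, 6 * W + 6 ≤ dL H L o)
    (hc : ∀ x ∈ L, ∀ y ∈ L, H.Adj x y → L.card ≤ (cm H L x y).card + W)
    (hc2 : ∀ x ∈ L, ∀ y ∈ L, H.Adj x y → l.length ≤ (cm H L x y).card + W)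
    {x0 y0 : V} (hx0 : x0 ∈ L) (hy0 : y0 ∈ L) (h0 : H.Adj x0 y0) : False := by
  have choice : ∀ o ∈ R, ∀ x ∈ L, ∀ y ∈ L, H.Adj x y → ∀ U : List V, U.length ≤ 5 * W + 5 →
      ∃ z, z ∈ L ∧ H.Adj x z ∧ H.Adj y z ∧ H.Adj o z ∧ z ∉ U := by
    intro o hoR x hx y hy h U hU
    have h1 := hrich o hoR
    have h2 := hc x hx y hy h
    unfold dL at h1
    set A := L.filter (fun z => H.Adj o z)
    have h3 := Finset.card_union_add_card_inter A (cm H L x y)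
    have h4 : (A ∪ cm H L x y).card ≤ L.card := by
      apply Finset.card_le_card
      apply Finset.union_subset (Finset.filter_subset _ _) (Finset.filter_subset _ _)
    obtain ⟨z, hz, hzU⟩ := exists_unused (A ∩ cm H L x y) U (by omega)
    rw [Finset.mem_inter, mem_cm, Finset.mem_filter] at hz
    exact ⟨z, hz.1.1, hz.2.2.1, hz.2.2.2, hz.1.2, hzU⟩
  -- phase 1
  have ph1 : ∀ j ≤ W + 1, ∃ x y Q, x ∈ L ∧ y ∈ L ∧ (x :: y :: Q).Nodup ∧ Sq H (x :: y :: Q) ∧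
      (∀ z ∈ x :: y :: Q, z ∈ L ∨ z ∈ l) ∧ (x :: y :: Q).length ≤ 5 * j + 2 ∧
      j ≤ (R ∩ (x :: y :: Q).toFinset).card := by
    intro j
    induction j with
    | zero =>
      intro _
      refine ⟨x0, y0, [], hx0, hy0, by simp [h0.ne], Sq_pair h0, by simp [hx0, hy0], by simp, by simp⟩
    | succ j ih =>
      intro hj
      obtain ⟨x, y, Q, hx, hy, nd, sq, sub, len, hcard⟩ := ih (by omega)
      by_cases hd : j + 1 ≤ (R ∩ (x :: y :: Q).toFinset).card
      · exact ⟨x, y, Q, hx, hy, nd, sq, sub, by omega, hd⟩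
      have : ∃ o ∈ R, o ∉ x :: y :: Q := by
        by_contra hcon
        push Not at hcon
        have : R ⊆ R ∩ (x :: y :: Q).toFinset := fun z hz =>
          Finset.mem_inter.2 ⟨hz, by simpa using hcon z hz⟩
        have := Finset.card_le_card this
        omega
      obtain ⟨o, hoR, hoU⟩ := this
      have hxy : H.Adj x y := sq.1 y (by simp)
      have hoL : ∀ z ∈ L, z ≠ o := fun z hz hzo => hLl z hz (hzo ▸ hR o hoR)
      obtain ⟨a, haL, hxa, hya, hoa, haU⟩ := choice o hoR x hx y hy hxy (x :: y :: Q) (by omega)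
      obtain ⟨b, hbL, hab, hxb, hob, hbU⟩ := choice o hoR a haL x hx hxa.symm (a :: x :: y :: Q)
        (by simp only [List.length_cons] at len ⊢; omega)
      obtain ⟨c, hcL, hbc, hac, hoc, hcU⟩ := choice o hoR b hbL a haL hab.symm
        (b :: a :: x :: y :: Q) (by simp only [List.length_cons] at len ⊢; omega)
      obtain ⟨d, hdL, hcd, hbd, hod, hdU⟩ := choice o hoR c hcL b hbL hbc.symm
        (c :: b :: a :: x :: y :: Q) (by simp only [List.length_cons] at len ⊢; omega)
      have sqa := Sq_cons sq hxa hya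
      have sqb := Sq_cons sqa hab hxb
      have sqo := Sq_cons sqb hob.symm hoa.symm
      have sqc := Sq_cons sqo hoc hbc
      have sqd := Sq_cons sqc hcd hod
      have nda := List.nodup_cons.2 ⟨haU, nd⟩
      have ndb := List.nodup_cons.2 ⟨hbU, nda⟩
      have ndo : (o :: b :: a :: x :: y :: Q).Nodup := by
        refine List.nodup_cons.2 ⟨?_, ndb⟩
        rw [List.mem_cons, List.mem_cons]
        rintro (h | h | h)
        · exact hoL b hbL h.symm
        · exact hoL a haL h.symm
        · exact hoU h
      have ndc : (c :: o :: b :: a :: x :: y :: Q).Nodup := by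
        refine List.nodup_cons.2 ⟨?_, ndo⟩
        rw [List.mem_cons]
        rintro (h | h)
        · exact hoL c hcL h
        · exact hcU h
      have ndd : (d :: c :: o :: b :: a :: x :: y :: Q).Nodup := by
        refine List.nodup_cons.2 ⟨?_, ndc⟩
        rw [List.mem_cons, List.mem_cons]
        rintro (h | h | h)
        · exact hdU (by simp [h])
        · exact hoL d hdL h
        · exact hdU (List.mem_cons_of_mem _ h)
      refine ⟨d, c, o :: b :: a :: x :: y :: Q, hdL, hcL, ndd, sqd, ?_, ?_, ?_⟩
      · intro z hz
        simp only [List.mem_cons] at hz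
        rcases hz with rfl | rfl | rfl | rfl | rfl | hz
        · exact Or.inl hdL
        · exact Or.inl hcL
        · exact Or.inr (hR _ hoR)
        · exact Or.inl hbL
        · exact Or.inl haL
        · exact sub z (by simpa using hz)
      · simp only [List.length_cons] at len ⊢; omega
      · have : insert o (R ∩ (x :: y :: Q).toFinset) ⊆
            R ∩ (d :: c :: o :: b :: a :: x :: y :: Q).toFinset := by
          intro z hz
          rw [Finset.mem_insert, Finset.mem_inter] at hz
          rcases hz with rfl | ⟨h1, h2⟩
          · simp [hoR]
          · refine Finset.mem_inter.2 ⟨h1, ?_⟩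
            simp only [List.mem_toFinset] at h2 ⊢
            iterate 5 apply List.mem_cons_of_mem
            exact h2
        have := Finset.card_le_card this
        rw [Finset.card_insert_of_notMem] at this
        · omega
        · rw [Finset.mem_inter, List.mem_toFinset]; exact fun h => hoU h.2
  have lenle : ∀ Q : List V, Q.Nodup → Sq H Q → (∀ z ∈ Q, z ∈ L ∨ z ∈ l) → Q.length ≤ l.length := by
    intro Q a b c
    refine ho.len Q a b fun z hz => ?_
    rcases c z hz with h | h
    · exact hLS h
    · exact ho.sub z h
  -- phase 2
  have ph2 : ∀ k, ∃ x y Q, x ∈ L ∧ y ∈ L ∧ (x :: y :: Q).Nodup ∧ Sq H (x :: y :: Q) ∧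
      (∀ z ∈ x :: y :: Q, z ∈ L ∨ z ∈ l) ∧ k ≤ (x :: y :: Q).length ∧
      W + 1 ≤ (R ∩ (x :: y :: Q).toFinset).card := by
    intro k
    induction k with
    | zero =>
      obtain ⟨x, y, Q, a, b, c, d, e, f, g⟩ := ph1 (W + 1) le_rfl
      exact ⟨x, y, Q, a, b, c, d, e, by omega, g⟩
    | succ k ih =>
      obtain ⟨x, y, Q, hx, hy, nd, sq, sub, len, hcard⟩ := ih
      have hle := lenle _ nd sq sub
      have hxy : H.Adj x y := sq.1 y (by simp)
      have h2 := hc2 x hx y hy hxy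
      have : ∃ z ∈ cm H L x y, z ∉ x :: y :: Q := by
        by_contra hcon
        push Not at hcon
        have hsub : cm H L x y ∪ (R ∩ (x :: y :: Q).toFinset) ⊆ (x :: y :: Q).toFinset := by
          apply Finset.union_subset
          · intro z hz; rw [List.mem_toFinset]; exact hcon z hz
          · exact Finset.inter_subset_right
        have := Finset.card_le_card hsub
        rw [Finset.card_union_of_disjoint, List.toFinset_card_of_nodup nd] at this
        · omega
        · rw [Finset.disjoint_left]
          intro z hz hz'
          exact hLl z (mem_cm.1 hz).1 (hR z (Finset.mem_inter.1 hz').1)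
      obtain ⟨z, hz, hzU⟩ := this
      rw [mem_cm] at hz
      refine ⟨z, x, y :: Q, hz.1, hx, List.nodup_cons.2 ⟨hzU, nd⟩, Sq_cons sq hz.2.1 hz.2.2, ?_, ?_, ?_⟩
      · intro w hw
        rw [List.mem_cons] at hw
        rcases hw with rfl | hw
        · exact Or.inl hz.1
        · exact sub w hw
      · rw [List.length_cons]; omega
      · refine hcard.trans (Finset.card_le_card ?_)
        apply Finset.inter_subset_inter_left
        intro w hw
        rw [List.mem_toFinset] at hw ⊢
        exact List.mem_cons_of_mem _ hw
  obtain ⟨x, y, Q, hx, hy, nd, sq, sub, len, hcard⟩ := ph2 (l.length + 1)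
  have := lenle _ nd sq sub
  omega

theorem dL_comm (A L : Finset V) : ∑ o ∈ A, dL H L o = ∑ x ∈ L, dL H A x := by
  unfold dL
  simp only [Finset.card_filter]
  rw [Finset.sum_comm]
  simp only [H.adj_comm]

theorem rich_sum (A L : Finset V) (W r : ℕ)
    (h : (A.filter (fun o => r ≤ dL H L o)).card ≤ W) :
    ∑ x ∈ L, dL H A x ≤ W * L.card + A.card * r := by
  rw [← dL_comm, ← Finset.sum_filter_add_sum_filter_not A (fun o => r ≤ dL H L o)]
  have h1 : ∑ o ∈ A.filter (fun o => r ≤ dL H L o), dL H L o ≤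
      (A.filter (fun o => r ≤ dL H L o)).card * L.card :=
    Finset.sum_le_card_nsmul _ _ _ fun o _ => dL_le _ _
  have h2 : ∑ o ∈ A.filter (fun o => ¬ r ≤ dL H L o), dL H L o ≤
      (A.filter (fun o => ¬ r ≤ dL H L o)).card * r := by
    refine Finset.sum_le_card_nsmul _ _ _ fun o ho => ?_
    have := (Finset.mem_filter.1 ho).2
    omega
  have h3 : (A.filter (fun o => ¬ r ≤ dL H L o)).card * r ≤ A.card * r :=
    Nat.mul_le_mul_right _ (Finset.card_filter_le _ _)
  have h4 : (A.filter (fun o => r ≤ dL H L o)).card * L.card ≤ W * L.card :=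
    Nat.mul_le_mul_right _ h
  omega

theorem arith (n D E W l t : ℤ) (hn : 6000 ≤ n) (hE : 500 * E ≤ 3 * n) (hE0 : 0 ≤ E)
    (hD : 2 * n ≤ 3 * D + E)
    (hW : W = 2 * E + 30) (hl : n ≤ 3 * l + W) (hl2 : 3 * l ≤ n + 2 * W) (ht : t + l = n)
    (h : l * D ≤ l * l + 2 * (W * l) + t * (6 * W + 6)) : False := by
  have hW1 : 1000 * W ≤ 17 * n := by omega
  have hu : 286 * n ≤ 1000 * (D - l - 2 * W) := by omega
  have hl3 : 327 * n ≤ 1000 * l := by omega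
  have ht3 : 1000 * t ≤ 673 * n := by omega
  have hr : 1000 * (6 * W + 6) ≤ 103 * n := by omega
  have h1 : (327 * n) * (286 * n) ≤ (1000 * l) * (1000 * (D - l - 2 * W)) :=
    mul_le_mul hl3 hu (by omega) (by omega)
  have h2 : (1000 * t) * (1000 * (6 * W + 6)) ≤ (673 * n) * (103 * n) :=
    mul_le_mul ht3 hr (by omega) (by omega)
  nlinarith

theorem core [Fintype V] {D E : ℕ} (hn : 6000 ≤ Fintype.card V)
    (hD : ∀ x, D ≤ H.degree x) (hDE : 2 * Fintype.card V ≤ 3 * D + E)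
    (hE : 500 * E ≤ 3 * Fintype.card V) :
    ∃ l1 l2 : List V, l1.Nodup ∧ l2.Nodup ∧ Sq H l1 ∧ Sq H l2 ∧ (∀ x ∈ l1, x ∉ l2) ∧
      5 * Fintype.card V < 6 * (l1.length + l2.length) + 4 * E := by
  obtain ⟨l1, l2, o1, o2⟩ := exists_pair (H := H)
  have hd : ∀ z ∈ l1, z ∉ l2 := fun z hz => by simpa using o1.sub z hz
  refine ⟨l1, l2, o1.nd, o2.nd, o1.sq, o2.sq, hd, ?_⟩
  by_contra hcon
  have hcard := card_split o1 o2
  have hdeg := deg_split o1 o2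
  obtain ⟨L, hL⟩ : ∃ L, L = Finset.univ \ (l1.toFinset ∪ l2.toFinset) := ⟨_, rfl⟩
  rw [← hL] at hcard
  simp only [← hL] at hdeg
  set n := Fintype.card V with hnn
  have hLS1 : L ⊆ Finset.univ \ l2.toFinset := by subst hL; intro z; simp
  have hLS2 : L ⊆ Finset.univ \ l1.toFinset := by subst hL; intro z; simp; tauto
  have hLl1 : ∀ z ∈ L, z ∉ l1 := by subst hL; intro z; simp; tauto
  have hLl2 : ∀ z ∈ L, z ∉ l2 := by subst hL; intro z; simp
  -- an edge in L
  obtain ⟨x0, hx0⟩ : L.Nonempty := by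
    rw [← Finset.card_pos]; omega
  obtain ⟨y0, hy0, h0⟩ : ∃ y0 ∈ L, H.Adj x0 y0 := by
    have v1 := o1.vert (hLS1 hx0) (hLl1 x0 hx0)
    have v2 := o2.vert (hLS2 hx0) (hLl2 x0 hx0)
    have d := hdeg x0
    have := hD x0
    have hpos : 0 < dL H L x0 := by omega
    unfold dL at hpos
    rw [Finset.card_pos] at hpos
    obtain ⟨y, hy⟩ := hpos
    rw [Finset.mem_filter] at hy
    exact ⟨y, hy⟩
  obtain ⟨m, hm2, hext, x1, hx1, y1, hy1, h1, hcm⟩ := Ext_max hx0 hy0 h0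
  have hineq := fun (x : V) (hx : x ∈ L) (y : V) (hy : y ∈ L) (h : H.Adj x y) =>
    edge_ineq o1 o2 hL hD hm2 hext hx hy h
  obtain ⟨Q, nd, sq, sub, len⟩ := hext x0 hx0 y0 hy0 h0
  have mp1 : m ≤ l1.length := len.trans (o1.len _ nd sq fun z hz => hLS1 (sub z hz))
  have mp2 : m ≤ l2.length := len.trans (o2.len _ nd sq fun z hz => hLS2 (sub z hz))
  have ml : m ≤ L.card := by
    have h1 : (x0 :: y0 :: Q).toFinset ⊆ L := fun z hz => sub z (by simpa using hz)
    have h2 := Finset.card_le_card h1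
    rw [List.toFinset_card_of_nodup nd] at h2
    omega
  have hi := hineq x1 hx1 y1 hy1 h1
  have hm1 : l1.length / 2 < m := by omega
  have hm2' : l2.length / 2 < m := by omega
  obtain ⟨W, hW⟩ : ∃ W, W = 2 * E + 30 := ⟨_, rfl⟩
  have hmW : n ≤ 3 * m + W := by omega
  have hcW : ∀ x ∈ L, ∀ y ∈ L, H.Adj x y → n ≤ 3 * (cm H L x y).card + W := by
    intro x hx y hy h
    have := hineq x hx y hy h
    omega
  have fc1 := fun hR => final_case (R := l1.toFinset.filter (fun o => 6 * W + 6 ≤ dL H L o)) (W := W)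
    o1 hLS1 hLl1 (by intro z; simp; tauto) hR (by intro z; simp)
    (fun x hx y hy h => by have := hcW x hx y hy h; omega)
    (fun x hx y hy h => by have := hcW x hx y hy h; omega) hx0 hy0 h0
  have fc2 := fun hR => final_case (R := l2.toFinset.filter (fun o => 6 * W + 6 ≤ dL H L o)) (W := W)
    o2 hLS2 hLl2 (by intro z; simp; tauto) hR (by intro z; simp)
    (fun x hx y hy h => by have := hcW x hx y hy h; omega)
    (fun x hx y hy h => by have := hcW x hx y hy h; omega) hx0 hy0 h0
  have r1 := rich_sum (H := H) l1.toFinset L W (6 * W + 6) (by by_contra h; exact fc1 (by omega))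
  have r2 := rich_sum (H := H) l2.toFinset L W (6 * W + 6) (by by_contra h; exact fc2 (by omega))
  rw [List.toFinset_card_of_nodup o1.nd] at r1
  rw [List.toFinset_card_of_nodup o2.nd] at r2
  have hs : L.card * D ≤ ∑ x ∈ L, (L.card + dL H l1.toFinset x + dL H l2.toFinset x) := by
    refine Finset.card_nsmul_le_sum _ _ _ fun x _ => ?_
    have d := hdeg x
    rw [countP_eq o1.nd, countP_eq o2.nd] at d
    have := hD x
    have := dL_le (H := H) L x
    omega
  rw [Finset.sum_add_distrib, Finset.sum_add_distrib, Finset.sum_const, smul_eq_mul] at hs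
  have hfin : L.card * D ≤ L.card * L.card + 2 * (W * L.card) +
      (l1.length + l2.length) * (6 * W + 6) := by
    rw [add_mul]; omega
  refine arith n D E W L.card ((l1.length + l2.length : ℕ) : ℤ) (by omega) (by omega) (by omega)
    (by omega) (by omega) (by omega) (by omega) (by omega) ?_
  exact_mod_cast hfin

theorem Sq_get : ∀ {l : List V}, Sq H l → ∀ (v0 : V) (i : ℕ),
    (i + 1 < l.length → H.Adj (l.getD i v0) (l.getD (i + 1) v0)) ∧
    (i + 2 < l.length → H.Adj (l.getD i v0) (l.getD (i + 2) v0))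
  | [], _, _, i => by simp
  | [a], _, _, i => by simp
  | [a, b], h, v0, i => by
    have := h.1 b (by simp)
    rcases i with _ | i <;> simp [this]
  | a :: b :: c :: l, h, v0, 0 => by
    have h1 := h.1 b (by simp)
    have h2 := h.1 c (by simp)
    simp [h1, h2]
  | a :: b :: c :: l, h, v0, i + 1 => by
    have := Sq_get h.2 v0 i
    simpa using this

theorem getD_inj {l : List V} (h : l.Nodup) (v0 : V) :
    Set.InjOn (fun i => l.getD i v0) (Set.Iio l.length) := by
  intro i hi j hj hij
  simp only [Set.mem_Iio] at hi hj
  simp only [List.getD_eq_getElem _ _ hi, List.getD_eq_getElem _ _ hj] at hij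
  exact (h.getElem_inj_iff).1 hij

end SqPath

/-- Path Cover Lemma, part (b): if `δ(H) ≥ (2/3 - ε) n`, `0 < ε ≤ 1/500`, and
`n ≥ 6000`, then `H` has two vertex-disjoint square paths `P₁`, `P₂` with
`|P₁| + |P₂| > (5/6 - 2ε) n`. -/
theorem stmt_8 {V : Type} [Fintype V] [DecidableEq V] (H : SimpleGraph V)
    [DecidableRel H.Adj] (ε : ℝ) (hε0 : 0 < ε) (hε : ε ≤ 1/500)
    (hn : 6000 ≤ Fintype.card V)
    (hδ : (2/3 - ε) * (Fintype.card V : ℝ) ≤ H.minDegree) :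
    ∃ (t₁ t₂ : ℕ) (p₁ p₂ : ℕ → V),
      Set.InjOn p₁ (Set.Iio t₁) ∧ Set.InjOn p₂ (Set.Iio t₂) ∧
      (∀ i < t₁, ∀ j < t₂, p₁ i ≠ p₂ j) ∧
      (∀ i, i + 1 < t₁ → H.Adj (p₁ i) (p₁ (i+1))) ∧
      (∀ i, i + 2 < t₁ → H.Adj (p₁ i) (p₁ (i+2))) ∧
      (∀ i, i + 1 < t₂ → H.Adj (p₂ i) (p₂ (i+1))) ∧
      (∀ i, i + 2 < t₂ → H.Adj (p₂ i) (p₂ (i+2))) ∧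
      (5/6 - 2*ε) * (Fintype.card V : ℝ) < (t₁ : ℝ) + t₂ := by
  obtain ⟨v0⟩ : Nonempty V := by
    rw [← Fintype.card_pos_iff]; omega
  obtain ⟨E, hE⟩ : ∃ E, E = 2 * Fintype.card V - 3 * H.minDegree := ⟨_, rfl⟩
  have hn0 : (0 : ℝ) < Fintype.card V := by
    have : (6000 : ℝ) ≤ Fintype.card V := by exact_mod_cast hn
    linarith
  have hp : 0 < ε * (Fintype.card V : ℝ) := mul_pos hε0 hn0
  have hEr : (E : ℝ) ≤ 3 * (ε * (Fintype.card V : ℝ)) := by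
    rcases Nat.eq_zero_or_pos E with h | h
    · rw [h]; push_cast; linarith
    · have h1 : E + 3 * H.minDegree = 2 * Fintype.card V := by omega
      have h2 : (E : ℝ) + 3 * H.minDegree = 2 * Fintype.card V := by exact_mod_cast h1
      nlinarith
  have hE5 : 500 * E ≤ 3 * Fintype.card V := by
    have : ε * (Fintype.card V : ℝ) ≤ 1/500 * Fintype.card V :=
      mul_le_mul_of_nonneg_right hε hn0.le
    have h3 : 500 * (E : ℝ) ≤ 3 * Fintype.card V := by linarith
    exact_mod_cast h3
  obtain ⟨l1, l2, n1, n2, s1, s2, hd, hlen⟩ := SqPath.core (H := H) (D := H.minDegree) (E := E) hn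
    (fun x => H.minDegree_le_degree x) (by omega) hE5
  refine ⟨l1.length, l2.length, fun i => l1.getD i v0, fun i => l2.getD i v0,
    SqPath.getD_inj n1 v0, SqPath.getD_inj n2 v0, ?_, fun i => (SqPath.Sq_get s1 v0 i).1,
    fun i => (SqPath.Sq_get s1 v0 i).2, fun i => (SqPath.Sq_get s2 v0 i).1,
    fun i => (SqPath.Sq_get s2 v0 i).2, ?_⟩
  · intro i hi j hj h
    simp only [List.getD_eq_getElem _ _ hi, List.getD_eq_getElem _ _ hj] at h
    exact hd _ (List.getElem_mem hi) (h ▸ List.getElem_mem hj)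
  · have h3 : 5 * (Fintype.card V : ℝ) < 6 * ((l1.length : ℝ) + l2.length) + 4 * E := by
      exact_mod_cast hlen
    nlinarith
end
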